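/- Krätzel's explicit estimate for ellipses: let a, b, c be real numbers with a > 0 and ac − b² = 1, and set Q(t₁,t₂) = a t₁² + 2b t₁t₂ + c t₂². Let A(x) = #{(m,n) ∈ ℤ² : Q(m,n) ≤ x²} and P(x) = A(x) − πx². Then for every real x ≥ 1: |P(x)| < 38·x^{2/3} + (3·a^{3/4} + 700·c^{3/4})·√x + 11. -/

import Mathlib

open Real

noncomputable def unitExp (t : ℝ) : ℂ := Complex.exp ((2 * π * t : ℝ) * Complex.I)

lemma norm_unitExp (t : ℝ) : ‖unitExp t‖ = 1 := Complex.norm_exp_ofReal_mul_I _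

lemma unitExp_add (s t : ℝ) : unitExp (s + t) = unitExp s * unitExp t := by
  simp only [unitExp, ← Complex.exp_add]
  congr 1
  push_cast
  ring

lemma unitExp_int (k : ℤ) : unitExp k = 1 := by
  rw [unitExp, Complex.exp_eq_one_iff]
  exact ⟨k, by push_cast; ring⟩

/-- The weight `(1 + i cot (π u)) / 2`, equal to `1 / (1 - unitExp u)` for non-integral `u`. -/
noncomputable def cotWeight (u : ℝ) : ℂ :=
  1 / 2 + ((cos (π * u) / sin (π * u) / 2 : ℝ) : ℂ) * Complex.I

lemma one_sub_unitExp_mul_cotWeight {u : ℝ} (hu : sin (π * u) ≠ 0) :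
    (1 - unitExp u) * cotWeight u = 1 := by
  have h : unitExp u = ((cos (π * u) : ℝ) + (sin (π * u) : ℝ) * Complex.I) ^ 2 := by
    rw [unitExp]
    push_cast
    rw [← Complex.exp_mul_I, ← Complex.exp_nat_mul]
    congr 1
    push_cast
    ring
  have hs : ((sin (π * u) : ℝ) : ℂ) ≠ 0 := by exact_mod_cast hu
  have h1 : ((sin (π * u) : ℝ) : ℂ) ^ 2 + ((cos (π * u) : ℝ) : ℂ) ^ 2 = 1 := by
    exact_mod_cast sin_sq_add_cos_sq (π * u)
  have hI : Complex.I ^ 2 = -1 := Complex.I_sq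
  rw [h, cotWeight]
  set s : ℂ := ((sin (π * u) : ℝ) : ℂ) with hs_def
  set q : ℂ := ((cos (π * u) : ℝ) : ℂ) with hq_def
  have e : ((cos (π * u) / sin (π * u) / 2 : ℝ) : ℂ) = q / s / 2 := by
    simp only [hs_def, hq_def]; push_cast; ring
  rw [e]
  field_simp
  linear_combination (s - q * Complex.I) * h1 +
    (-s ^ 3 - 2 * q ^ 2 * s - q * s ^ 2 * Complex.I) * hI

lemma two_mul_le_sin_pi_mul {θ u : ℝ} (hθ : 0 < θ) (h1 : θ ≤ u) (h2 : u ≤ 1 - θ) :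
    2 * θ ≤ sin (π * u) := by
  have hp := pi_pos
  rcases le_total u (1 / 2) with h | h
  · have := mul_le_sin (x := π * u) (by nlinarith) (by nlinarith)
    have e : 2 / π * (π * u) = 2 * u := by field_simp
    linarith
  · have := mul_le_sin (x := π * (1 - u)) (by nlinarith) (by nlinarith)
    have e : 2 / π * (π * (1 - u)) = 2 * (1 - u) := by field_simp
    have e2 : sin (π * (1 - u)) = sin (π * u) := by
      rw [← sin_pi_sub]; congr 1; ring
    linarith

lemma abs_cot_le {θ u : ℝ} (hθ : 0 < θ) (h1 : θ ≤ u) (h2 : u ≤ 1 - θ) :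
    |cos (π * u) / sin (π * u)| ≤ 1 / (2 * θ) := by
  have h := two_mul_le_sin_pi_mul hθ h1 h2
  rw [abs_div, abs_of_pos (by linarith : 0 < sin (π * u))]
  exact div_le_div₀ zero_le_one (abs_cos_le_one _) (by linarith) h

lemma norm_cotWeight_le {θ u : ℝ} (hθ : 0 < θ) (h1 : θ ≤ u) (h2 : u ≤ 1 - θ) :
    ‖cotWeight u‖ ≤ 1 / (4 * θ) := by
  have h := two_mul_le_sin_pi_mul hθ h1 h2
  have hs : 0 < sin (π * u) := by linarith
  have e : ‖cotWeight u‖ ^ 2 = (1 / (2 * sin (π * u))) ^ 2 := by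
    have hr : ∀ r : ℝ, Complex.normSq (1 / 2 + ((r / 2 : ℝ) : ℂ) * Complex.I) =
        (1 + r ^ 2) / 4 := by
      intro r
      rw [show (1 / 2 : ℂ) = ((1 / 2 : ℝ) : ℂ) by push_cast; rfl, Complex.normSq_add_mul_I]
      ring
    rw [← Complex.normSq_eq_norm_sq, cotWeight, hr]
    field_simp
    linarith [sin_sq_add_cos_sq (π * u)]
  have e2 : ‖cotWeight u‖ = 1 / (2 * sin (π * u)) :=
    (sq_eq_sq₀ (norm_nonneg _) (by positivity)).1 e
  rw [e2]
  exact one_div_le_one_div_of_le (by linarith) (by linarith)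

lemma norm_cotWeight_sub {θ u v : ℝ} (hθ : 0 < θ) (h1 : θ ≤ u) (huv : u ≤ v) (h2 : v ≤ 1 - θ) :
    ‖cotWeight v - cotWeight u‖ =
      (cos (π * u) / sin (π * u) - cos (π * v) / sin (π * v)) / 2 := by
  have hu := two_mul_le_sin_pi_mul hθ h1 (huv.trans h2)
  have hv := two_mul_le_sin_pi_mul hθ (h1.trans huv) h2
  have hu' : 0 < sin (π * u) := by linarith
  have hv' : 0 < sin (π * v) := by linarith
  have e : cos (π * u) / sin (π * u) - cos (π * v) / sin (π * v) =
      sin (π * v - π * u) / (sin (π * u) * sin (π * v)) := by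
    rw [sin_sub]; field_simp
  have hp := pi_pos
  have h0 : 0 ≤ sin (π * v - π * u) :=
    sin_nonneg_of_nonneg_of_le_pi (by nlinarith) (by nlinarith)
  have e3 : cotWeight v - cotWeight u =
      ((-((cos (π * u) / sin (π * u) - cos (π * v) / sin (π * v)) / 2) : ℝ) : ℂ) * Complex.I := by
    simp only [cotWeight]; push_cast; ring
  rw [e3, norm_mul, Complex.norm_I, mul_one, Complex.norm_real, norm_neg, Real.norm_eq_abs,
    abs_of_nonneg]
  rw [e]; positivity

/-- The Kusmin-Landau inequality. -/
lemma norm_sum_unitExp_le_of_diff {f : ℕ → ℝ} {n : ℕ} {θ : ℝ} {k : ℤ} (hθ : 0 < θ)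
    (hlo : ∀ i < n, k + θ ≤ f (i + 1) - f i) (hhi : ∀ i < n, f (i + 1) - f i ≤ k + 1 - θ)
    (hmono : ∀ i, i + 1 < n → f (i + 1) - f i ≤ f (i + 2) - f (i + 1)) :
    ‖∑ i ∈ Finset.range n, unitExp (f i)‖ ≤ 1 / θ := by
  set u : ℕ → ℝ := fun i => f (i + 1) - f i - k with hu
  have hlo' : ∀ i < n, θ ≤ u i := fun i hi => by have := hlo i hi; simp only [hu]; linarith
  have hhi' : ∀ i < n, u i ≤ 1 - θ := fun i hi => by have := hhi i hi; simp only [hu]; linarith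
  have hstep : ∀ i < n, unitExp (f i) + unitExp (f (i + 1)) * cotWeight (u i) =
      unitExp (f i) * cotWeight (u i) := by
    intro i hi
    have h := two_mul_le_sin_pi_mul hθ (hlo' i hi) (hhi' i hi)
    have h1 := one_sub_unitExp_mul_cotWeight (u := u i) (by linarith)
    have h2 : unitExp (f (i + 1)) = unitExp (f i) * unitExp (u i) := by
      have : f (i + 1) = f i + u i + k := by simp only [hu]; ring
      rw [this, unitExp_add, unitExp_int, unitExp_add, mul_one]
    rw [h2]
    linear_combination -unitExp (f i) * h1
  have key : ∀ m, m < n → ‖∑ i ∈ Finset.range (m + 1), unitExp (f i) +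
      unitExp (f (m + 1)) * cotWeight (u m)‖ ≤ 1 / (4 * θ) +
      (cos (π * u 0) / sin (π * u 0) - cos (π * u m) / sin (π * u m)) / 2 := by
    intro m
    induction m with
    | zero =>
      intro hm
      have := norm_cotWeight_le hθ (hlo' 0 hm) (hhi' 0 hm)
      rw [Finset.sum_range_one, hstep 0 hm, norm_mul, norm_unitExp]
      simpa using this
    | succ m ih =>
      intro hm
      have h1 := ih (by omega)
      have h2 := norm_cotWeight_sub hθ (hlo' m (by omega))
        (by have := hmono m hm; simp only [hu]; linarith) (hhi' (m + 1) hm)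
      rw [Finset.sum_range_succ, add_assoc, hstep (m + 1) hm]
      have e : ∑ i ∈ Finset.range (m + 1), unitExp (f i) +
          unitExp (f (m + 1)) * cotWeight (u (m + 1)) =
          (∑ i ∈ Finset.range (m + 1), unitExp (f i) + unitExp (f (m + 1)) * cotWeight (u m)) +
          unitExp (f (m + 1)) * (cotWeight (u (m + 1)) - cotWeight (u m)) := by ring
      rw [e]
      refine (norm_add_le _ _).trans ?_
      rw [norm_mul, norm_unitExp, one_mul, h2]
      linarith
  rcases n with _ | n
  · simp; positivity
  · have h := key n (by omega)
    have h1 := norm_cotWeight_le hθ (hlo' n (by omega)) (hhi' n (by omega))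
    have h2 := abs_le.1 (abs_cot_le hθ (hlo' 0 (by omega)) (hhi' 0 (by omega)))
    have h3 := abs_le.1 (abs_cot_le hθ (hlo' n (by omega)) (hhi' n (by omega)))
    have e : ∑ i ∈ Finset.range (n + 1), unitExp (f i) =
        (∑ i ∈ Finset.range (n + 1), unitExp (f i) + unitExp (f (n + 1)) * cotWeight (u n)) -
        unitExp (f (n + 1)) * cotWeight (u n) := by ring
    rw [e]
    refine (norm_sub_le _ _).trans ?_
    rw [norm_mul, norm_unitExp, one_mul]
    have e1 : 1 / θ = 4 * (1 / (4 * θ)) := by field_simp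
    have e2 : 1 / (2 * θ) = 2 * (1 / (4 * θ)) := by field_simp; norm_num
    linarith [h2.2, h3.1]

lemma card_le_of_spacing {S : Finset ℕ} {d : ℕ → ℝ} {μ u w : ℝ} (hμ : 0 < μ) (hw : 0 ≤ w)
    (hd : ∀ i ∈ S, ∀ j ∈ S, i ≤ j → μ * ((j : ℝ) - i) ≤ d j - d i)
    (hu : ∀ i ∈ S, u ≤ d i) (huw : ∀ i ∈ S, d i ≤ u + w) :
    (S.card : ℝ) ≤ w / μ + 1 := by
  rcases S.eq_empty_or_nonempty with rfl | hS
  · simp; positivity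
  have h1 : S ⊆ Finset.Icc (S.min' hS) (S.max' hS) := fun i hi =>
    Finset.mem_Icc.2 ⟨S.min'_le i hi, S.le_max' i hi⟩
  have h2 := Finset.card_le_card h1
  rw [Nat.card_Icc] at h2
  have h3 : S.min' hS ≤ S.max' hS := S.min'_le _ (S.max'_mem hS)
  have h4 := hd _ (S.min'_mem hS) _ (S.max'_mem hS) h3
  have h5 := hu _ (S.min'_mem hS)
  have h6 := huw _ (S.max'_mem hS)
  have h7 : (S.card : ℝ) + S.min' hS ≤ S.max' hS + 1 := by
    have : S.card + S.min' hS ≤ S.max' hS + 1 := by omega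
    exact_mod_cast this
  have h8 : ((S.max' hS : ℕ) : ℝ) - S.min' hS ≤ w / μ := by
    rw [le_div_iff₀ hμ]; linarith
  linarith

lemma norm_sum_unitExp_le_card (S : Finset ℕ) (f : ℕ → ℝ) :
    ‖∑ i ∈ S, unitExp (f i)‖ ≤ S.card := by
  refine (norm_sum_le _ _).trans ?_
  simp [norm_unitExp]

lemma norm_sum_unitExp_le_of_ordConnected {S : Finset ℕ} {f : ℕ → ℝ} {θ : ℝ} {k : ℤ} (hθ : 0 < θ)
    (hS : ∀ i ∈ S, ∀ j ∈ S, Finset.Icc i j ⊆ S)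
    (hlo : ∀ i ∈ S, k + θ ≤ f (i + 1) - f i) (hhi : ∀ i ∈ S, f (i + 1) - f i ≤ k + 1 - θ)
    (hmono : ∀ i ∈ S, i + 1 ∈ S → f (i + 1) - f i ≤ f (i + 2) - f (i + 1)) :
    ‖∑ i ∈ S, unitExp (f i)‖ ≤ 1 / θ := by
  rcases S.eq_empty_or_nonempty with rfl | hne
  · simp; positivity
  set a := S.min' hne
  set b := S.max' hne
  have hab : a ≤ b := S.min'_le _ (S.max'_mem hne)
  have e : S = Finset.Ico a (b + 1) := by
    ext i
    rw [Finset.mem_Ico, Nat.lt_succ_iff]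
    constructor
    · exact fun hi => ⟨S.min'_le i hi, S.le_max' i hi⟩
    · exact fun hi => hS a (S.min'_mem hne) b (S.max'_mem hne) (Finset.mem_Icc.2 hi)
  have hmem : ∀ i, i < b + 1 - a → a + i ∈ S := by
    intro i hi; rw [e, Finset.mem_Ico]; omega
  rw [e, Finset.sum_Ico_eq_sum_range]
  refine norm_sum_unitExp_le_of_diff (f := fun i => f (a + i)) (k := k) hθ ?_ ?_ ?_
  · exact fun i hi => hlo _ (hmem i hi)
  · exact fun i hi => hhi _ (hmem i hi)
  · exact fun i hi => hmono _ (hmem i (by omega)) (hmem (i + 1) hi)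

lemma norm_sum_unitExp_fiber_le {S : Finset ℕ} {f : ℕ → ℝ} {θ μ : ℝ} {k : ℤ} (hθ : 0 < θ)
    (hμ : 0 < μ) (hS : ∀ i ∈ S, ∀ j ∈ S, Finset.Icc i j ⊆ S)
    (hlo : ∀ i ∈ S, k ≤ f (i + 1) - f i) (hhi : ∀ i ∈ S, f (i + 1) - f i ≤ k + 1)
    (hd : ∀ i ∈ S, ∀ j ∈ S, i ≤ j →
      μ * ((j : ℝ) - i) ≤ (f (j + 1) - f j) - (f (i + 1) - f i)) :
    ‖∑ i ∈ S, unitExp (f i)‖ ≤ 2 * (θ / μ + 1) + 1 / θ := by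
  classical
  set d : ℕ → ℝ := fun i => f (i + 1) - f i with hd_def
  have hmono : ∀ i ∈ S, ∀ j ∈ S, i ≤ j → d i ≤ d j := by
    intro i hi j hj hij
    have := hd i hi j hj hij
    have h2 : (i : ℝ) ≤ j := by exact_mod_cast hij
    have : 0 ≤ μ * ((j : ℝ) - i) := mul_nonneg hμ.le (by linarith)
    simp only [hd_def]; linarith
  set S1 := S.filter (fun i => d i < k + θ)
  set S2 := (S.filter (fun i => ¬ d i < k + θ)).filter (fun i => d i ≤ k + 1 - θ)
  set S3 := (S.filter (fun i => ¬ d i < k + θ)).filter (fun i => ¬ d i ≤ k + 1 - θ)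
  have hsplit : ∑ i ∈ S, unitExp (f i) = ∑ i ∈ S1, unitExp (f i) +
      (∑ i ∈ S2, unitExp (f i) + ∑ i ∈ S3, unitExp (f i)) := by
    rw [Finset.sum_filter_add_sum_filter_not, Finset.sum_filter_add_sum_filter_not]
  have h1 : (S1.card : ℝ) ≤ θ / μ + 1 := by
    refine card_le_of_spacing (d := d) (u := k) hμ hθ.le ?_ ?_ ?_
    · exact fun i hi j hj => hd i (Finset.mem_filter.1 hi).1 j (Finset.mem_filter.1 hj).1
    · exact fun i hi => hlo i (Finset.mem_filter.1 hi).1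
    · exact fun i hi => (Finset.mem_filter.1 hi).2.le
  have h3 : (S3.card : ℝ) ≤ θ / μ + 1 := by
    have hm : ∀ i ∈ S3, i ∈ S := fun i hi =>
      (Finset.mem_filter.1 (Finset.mem_filter.1 hi).1).1
    refine card_le_of_spacing (d := d) (u := k + 1 - θ) hμ hθ.le ?_ ?_ ?_
    · exact fun i hi j hj => hd i (hm i hi) j (hm j hj)
    · exact fun i hi => (not_le.1 (Finset.mem_filter.1 hi).2).le
    · exact fun i hi => by have := hhi i (hm i hi); simp only [hd_def]; linarith
  have h2 : ‖∑ i ∈ S2, unitExp (f i)‖ ≤ 1 / θ := by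
    have hm : ∀ i, i ∈ S2 ↔ i ∈ S ∧ k + θ ≤ d i ∧ d i ≤ k + 1 - θ := by
      intro i; simp only [S2, Finset.mem_filter, not_lt]; tauto
    refine norm_sum_unitExp_le_of_ordConnected (k := k) hθ ?_ ?_ ?_ ?_
    · intro i hi j hj l hl
      rw [hm] at hi hj ⊢
      have hlS := hS i hi.1 j hj.1 hl
      rw [Finset.mem_Icc] at hl
      exact ⟨hlS, hi.2.1.trans (hmono i hi.1 l hlS hl.1), (hmono l hlS j hj.1 hl.2).trans hj.2.2⟩
    · exact fun i hi => ((hm i).1 hi).2.1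
    · exact fun i hi => ((hm i).1 hi).2.2
    · exact fun i hi hi' => hmono i ((hm i).1 hi).1 (i + 1) ((hm _).1 hi').1 (by omega)
  rw [hsplit]
  have n1 := norm_sum_unitExp_le_card S1 f
  have n3 := norm_sum_unitExp_le_card S3 f
  refine (norm_add_le _ _).trans ?_
  have := norm_add_le (∑ i ∈ S2, unitExp (f i)) (∑ i ∈ S3, unitExp (f i))
  linarith

/-- A form of van der Corput's second derivative test for finite differences. -/
lemma norm_sum_unitExp_le_of_second_diff {f : ℕ → ℝ} {n : ℕ} {μ α θ : ℝ} (hμ : 0 < μ)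
    (hα : 0 ≤ α) (hθ : 0 < θ)
    (hlo : ∀ i, i + 2 < n → μ ≤ f (i + 2) - 2 * f (i + 1) + f i)
    (hhi : ∀ i, i + 2 < n → f (i + 2) - 2 * f (i + 1) + f i ≤ α * μ) :
    ‖∑ i ∈ Finset.range n, unitExp (f i)‖ ≤
      (α * μ * n + 2) * (2 * (θ / μ + 1) + 1 / θ) + 1 := by
  classical
  have hB : 0 ≤ 2 * (θ / μ + 1) + 1 / θ := by positivity
  rcases n with _ | n
  · simp; positivity
  set d : ℕ → ℝ := fun i => f (i + 1) - f i with hd_def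
  have hspace : ∀ i j, i ≤ j → j < n → μ * ((j : ℝ) - i) ≤ d j - d i ∧
      d j - d i ≤ α * μ * ((j : ℝ) - i) := by
    intro i j hij
    induction j, hij using Nat.le_induction with
    | base => intro _; simp
    | succ j hij ih =>
      intro hj
      have h1 := ih (by omega)
      have h2 := hlo j (by omega)
      have h3 := hhi j (by omega)
      simp only [hd_def] at h1 ⊢
      push_cast
      constructor <;> nlinarith
  have hmono : ∀ i j, i ≤ j → j < n → d i ≤ d j := by
    intro i j hij hj
    have h1 := (hspace i j hij hj).1
    have h2 : (i : ℝ) ≤ j := by exact_mod_cast hij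
    have : 0 ≤ μ * ((j : ℝ) - i) := mul_nonneg hμ.le (by linarith)
    linarith
  rw [Finset.sum_range_succ]
  refine (norm_add_le _ _).trans ?_
  rw [norm_unitExp]
  refine add_le_add ?_ le_rfl
  rcases n with _ | n
  · simp; positivity
  set K := Finset.Icc ⌊d 0⌋ ⌊d n⌋ with hK
  have hmaps : ∀ i ∈ Finset.range (n + 1), ⌊d i⌋ ∈ K := by
    intro i hi
    rw [Finset.mem_range] at hi
    exact Finset.mem_Icc.2 ⟨Int.floor_mono (hmono 0 i (by omega) hi),
      Int.floor_mono (hmono i n (by omega) (by omega))⟩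
  rw [← Finset.sum_fiberwise_of_maps_to hmaps]
  have hfib : ∀ k ∈ K, ‖∑ i ∈ (Finset.range (n + 1)).filter (fun i => ⌊d i⌋ = k),
      unitExp (f i)‖ ≤ 2 * (θ / μ + 1) + 1 / θ := by
    intro k _
    have hm : ∀ i, i ∈ (Finset.range (n + 1)).filter (fun i => ⌊d i⌋ = k) ↔
        i < n + 1 ∧ ⌊d i⌋ = k := by
      intro i; rw [Finset.mem_filter, Finset.mem_range]
    refine norm_sum_unitExp_fiber_le (k := k) hθ hμ ?_ ?_ ?_ ?_
    · intro i hi j hj l hl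
      rw [hm] at hi hj ⊢
      rw [Finset.mem_Icc] at hl
      have hl' : l < n + 1 := by omega
      refine ⟨hl', le_antisymm ?_ ?_⟩
      · rw [← hj.2]; exact Int.floor_mono (hmono l j hl.2 hj.1)
      · rw [← hi.2]; exact Int.floor_mono (hmono i l hl.1 hl')
    · intro i hi
      rw [← ((hm i).1 hi).2]; exact Int.floor_le _
    · intro i hi
      rw [← ((hm i).1 hi).2]; exact (Int.lt_floor_add_one _).le
    · exact fun i hi j hj hij => (hspace i j hij ((hm j).1 hj).1).1
  have hcard : (K.card : ℝ) ≤ α * μ * ((n + 1 + 1 : ℕ) : ℝ) + 2 := by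
    have h0 : ⌊d 0⌋ ≤ ⌊d n⌋ := Int.floor_mono (hmono 0 n (by omega) (by omega))
    have h1 : (K.card : ℝ) = (⌊d n⌋ : ℝ) + 1 - ⌊d 0⌋ := by
      have : (K.card : ℤ) = ⌊d n⌋ + 1 - ⌊d 0⌋ := by
        rw [hK, Int.card_Icc, Int.toNat_of_nonneg (by omega)]
      exact_mod_cast this
    have h2 := (hspace 0 n (by omega) (by omega)).2
    have h3 := Int.floor_le (d n)
    have h4 := Int.lt_floor_add_one (d 0)
    push_cast at h2 ⊢
    have h5 : 0 ≤ α * μ := by positivity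
    rw [h1]
    nlinarith
  calc _ ≤ ∑ k ∈ K, ‖∑ i ∈ (Finset.range (n + 1)).filter (fun i => ⌊d i⌋ = k),
        unitExp (f i)‖ := norm_sum_le _ _
    _ ≤ ∑ k ∈ K, (2 * (θ / μ + 1) + 1 / θ) := Finset.sum_le_sum hfib
    _ = K.card * (2 * (θ / μ + 1) + 1 / θ) := by rw [Finset.sum_const, nsmul_eq_mul]
    _ ≤ _ := mul_le_mul_of_nonneg_right hcard hB

/-- The second derivative test when the second differences vary by a factor of at most `2 √2`. -/
lemma norm_sum_unitExp_le_sqrt {f : ℕ → ℝ} {n : ℕ} {μ : ℝ} (hμ : 0 < μ)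
    (hlo : ∀ i, i + 2 < n → μ ≤ f (i + 2) - 2 * f (i + 1) + f i)
    (hhi : ∀ i, i + 2 < n → f (i + 2) - 2 * f (i + 1) + f i ≤ 2 * √2 * μ) :
    ‖∑ i ∈ Finset.range n, unitExp (f i)‖ ≤ 8.7 * (n * √μ) + 7 / √μ := by
  have hs : 0 < √μ := sqrt_pos.2 hμ
  set s := √μ with hs_def
  have hss : μ = s ^ 2 := (sq_sqrt hμ.le).symm
  have hn : (0 : ℝ) ≤ n := Nat.cast_nonneg n
  rcases le_total (1 / 8.7) s with h | h
  · have h1 := norm_sum_unitExp_le_card (Finset.range n) f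
    rw [Finset.card_range] at h1
    have h2 : (n : ℝ) ≤ 8.7 * (n * s) := by
      have : (1 : ℝ) ≤ 8.7 * s := by linarith
      nlinarith
    have : 0 ≤ 7 / s := by positivity
    linarith
  · set r := √2 with hr_def
    have hr : r ^ 2 = 2 := sq_sqrt (by norm_num)
    have hr0 : 0 < r := sqrt_pos.2 (by norm_num)
    have hr1 : r ≤ 1.415 := by
      rw [hr_def, sqrt_le_left (by norm_num)]; norm_num
    have key := norm_sum_unitExp_le_of_second_diff (α := 2 * r) (θ := s / r) hμ (by positivity)
      (by positivity) hlo hhi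
    have e : 2 * (s / r / μ + 1) + 1 / (s / r) = 2 * r / s + 2 := by
      rw [hss]; field_simp; linear_combination -hr
    rw [e] at key
    refine key.trans ?_
    have e2 : (2 * r * μ * n + 2) * (2 * r / s + 2) + 1 =
        (n * s) * (4 * r ^ 2 + 4 * r * s) + (4 * r + 5 * s) / s := by
      rw [hss]; field_simp; ring
    rw [e2, hr]
    have h3 : 4 * (2:ℝ) + 4 * r * s ≤ 8.7 := by nlinarith
    have h4 : 4 * r + 5 * s ≤ 7 := by norm_num at h ⊢; linarith
    have h5 : (4 * r + 5 * s) / s ≤ 7 / s := div_le_div_of_nonneg_right h4 hs.le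
    have h6 := mul_le_mul_of_nonneg_left h3 (mul_nonneg hn hs.le)
    linarith

noncomputable def sawtooth (y : ℝ) : ℝ := Int.fract y - 1 / 2

/-- The continuous periodic antiderivative of `sawtooth` with mean zero. -/
noncomputable def sawtoothPrim (y : ℝ) : ℝ := (Int.fract y ^ 2 - Int.fract y + 1 / 6) / 2

lemma abs_sawtooth_le (y : ℝ) : |sawtooth y| ≤ 1 / 2 := by
  have h1 := Int.fract_nonneg y
  have h2 := Int.fract_lt_one y
  rw [sawtooth, abs_le]
  constructor <;> linarith

lemma hasSum_sawtoothPrim (y : ℝ) :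
    HasSum (fun n : ℕ => 1 / (2 * π ^ 2 * (n : ℝ) ^ 2) * cos (2 * π * n * y)) (sawtoothPrim y) := by
  have h := hasSum_one_div_nat_pow_mul_cos (k := 1) one_ne_zero
    (x := Int.fract y) ⟨Int.fract_nonneg y, (Int.fract_lt_one y).le⟩
  have h2 := h.mul_left (1 / (2 * π ^ 2))
  have hp : π ^ 2 ≠ 0 := by positivity
  have e1 : (fun n : ℕ => 1 / (2 * π ^ 2 * (n : ℝ) ^ 2) * cos (2 * π * n * y)) =
      fun n : ℕ => 1 / (2 * π ^ 2) *
        (1 / (n : ℝ) ^ (2 * 1) * cos (2 * π * n * Int.fract y)) := by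
    funext n
    have e : cos (2 * π * n * y) = cos (2 * π * n * Int.fract y) := by
      have : 2 * π * n * y = 2 * π * n * Int.fract y + ((n * ⌊y⌋ : ℤ) : ℝ) * (2 * π) := by
        push_cast
        linear_combination (-2 * π * n) * Int.floor_add_fract y
      rw [this, cos_add_int_mul_two_pi]
    rw [e, mul_one]
    by_cases hn : (n : ℝ) = 0
    · simp [hn]
    · field_simp
  have e2 : sawtoothPrim y = 1 / (2 * π ^ 2) *
      ((-1) ^ (1 + 1) * (2 * π) ^ (2 * 1) / 2 / ((2 * 1).factorial : ℝ) *
        (Polynomial.map (algebraMap ℚ ℝ) (Polynomial.bernoulli (2 * 1))).eval (Int.fract y)) := by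
    rw [Polynomial.bernoulli, sawtoothPrim]
    simp [Finset.sum_range_succ, bernoulli_one, bernoulli_two]
    field_simp
    ring
  rw [e1, e2]
  exact h2

lemma fract_sub_of_le {y δ : ℝ} (h0 : 0 ≤ δ) (h : δ ≤ Int.fract y) :
    Int.fract (y - δ) = Int.fract y - δ := by
  rw [Int.fract_eq_iff]
  refine ⟨by linarith, by linarith [Int.fract_lt_one y], ⌊y⌋, ?_⟩
  linarith [Int.floor_add_fract y]

lemma fract_sub_of_lt {y δ : ℝ} (h1 : δ ≤ 1) (h : Int.fract y < δ) :
    Int.fract (y - δ) = Int.fract y - δ + 1 := by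
  rw [Int.fract_eq_iff]
  refine ⟨by linarith [Int.fract_nonneg y], by linarith, ⌊y⌋ - 1, ?_⟩
  push_cast
  linarith [Int.floor_add_fract y]

lemma sawtooth_le {δ : ℝ} (h0 : 0 < δ) (h1 : δ ≤ 1) (y : ℝ) :
    sawtooth y ≤ (sawtoothPrim y - sawtoothPrim (y - δ)) / δ + δ / 2 := by
  rw [← sub_le_iff_le_add, le_div_iff₀ h0, sawtooth, sawtoothPrim, sawtoothPrim]
  rcases le_or_gt δ (Int.fract y) with h | h
  · rw [fract_sub_of_le h0.le h]; nlinarith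
  · rw [fract_sub_of_lt h1 h]; nlinarith

lemma le_sawtooth {δ : ℝ} (h0 : 0 < δ) (h1 : δ ≤ 1) (y : ℝ) :
    (sawtoothPrim (y + δ) - sawtoothPrim y) / δ - δ / 2 ≤ sawtooth y := by
  rw [sub_le_iff_le_add, div_le_iff₀ h0]
  obtain ⟨z, hz⟩ : ∃ z, z = y + δ := ⟨_, rfl⟩
  obtain rfl : y = z - δ := by linarith
  rw [sawtooth, sawtoothPrim, sawtoothPrim, sub_add_cancel]
  have h2 := Int.fract_lt_one z
  rcases le_or_gt δ (Int.fract z) with h | h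
  · rw [fract_sub_of_le h0.le h]; nlinarith
  · rw [fract_sub_of_lt h1 h]; nlinarith [Int.fract_nonneg z]

lemma sum_min_div_sq_mul_sqrt_le {H : ℕ} (hH : 1 ≤ H) (n : ℕ) :
    ∑ h ∈ Finset.range n, min (H : ℝ) h / (h : ℝ) ^ 2 * √h ≤ 4 * √H := by
  have hHr : (1 : ℝ) ≤ H := by exact_mod_cast hH
  have h1 : ∀ m, m ≤ H →
      ∑ h ∈ Finset.range (m + 1), min (H : ℝ) h / (h : ℝ) ^ 2 * √h ≤ 2 * √m := by
    intro m
    induction m with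
    | zero => intro _; simp
    | succ m ih =>
      intro hm
      have h2 := ih (by omega)
      rw [Finset.sum_range_succ, min_eq_right (by exact_mod_cast hm)]
      have hp : 0 ≤ √(m : ℝ) := sqrt_nonneg _
      have hp2 : √(m : ℝ) ^ 2 = m := sq_sqrt (Nat.cast_nonneg _)
      have hq : 0 < √((m + 1 : ℕ) : ℝ) := sqrt_pos.2 (by positivity)
      have hq2 : √((m + 1 : ℕ) : ℝ) ^ 2 = (m + 1 : ℕ) := sq_sqrt (Nat.cast_nonneg _)
      set p := √(m : ℝ)
      set q := √((m + 1 : ℕ) : ℝ)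
      rw [← hq2]
      have e : q ^ 2 / (q ^ 2) ^ 2 * q = 1 / q := by field_simp
      have hpq : q ^ 2 = p ^ 2 + 1 := by rw [hq2, hp2]; push_cast; ring
      have : 1 / q ≤ 2 * (q - p) := by
        rw [div_le_iff₀ hq]; nlinarith [sq_nonneg (q - p)]
      rw [e]; linarith
  have h2 : ∀ m, H ≤ m →
      ∑ h ∈ Finset.range (m + 1), min (H : ℝ) h / (h : ℝ) ^ 2 * √h ≤ 4 * √H - 2 * H / √m := by
    intro m hm
    induction m, hm using Nat.le_induction with
    | base =>
      refine (h1 H le_rfl).trans_eq ?_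
      have hq : 0 < √(H : ℝ) := sqrt_pos.2 (by linarith)
      have hq2 : √(H : ℝ) ^ 2 = H := sq_sqrt (by linarith)
      field_simp
      linear_combination (-2 : ℝ) * hq2
    | succ m hm ih =>
      rw [Finset.sum_range_succ, min_eq_left (by exact_mod_cast (by omega : H ≤ m + 1))]
      have hm' : (1 : ℝ) ≤ m := by exact_mod_cast hH.trans hm
      have hp : 0 < √(m : ℝ) := sqrt_pos.2 (by linarith)
      have hp2 : √(m : ℝ) ^ 2 = m := sq_sqrt (Nat.cast_nonneg _)
      have hq : 0 < √((m + 1 : ℕ) : ℝ) := sqrt_pos.2 (by positivity)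
      have hq2 : √((m + 1 : ℕ) : ℝ) ^ 2 = (m + 1 : ℕ) := sq_sqrt (Nat.cast_nonneg _)
      set p := √(m : ℝ)
      set q := √((m + 1 : ℕ) : ℝ)
      rw [← hq2]
      have hpq : q ^ 2 = p ^ 2 + 1 := by rw [hq2, hp2]; push_cast; ring
      have hlt : p ≤ q := by nlinarith
      have e : (H : ℝ) / (q ^ 2) ^ 2 * q = H * (1 / q ^ 3) := by field_simp
      have h3 : 1 / q ^ 3 ≤ 2 / p - 2 / q := by
        rw [div_sub_div _ _ hp.ne' hq.ne', div_le_div_iff₀ (by positivity) (by positivity)]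
        have h5 : 1 ≤ 2 * q * (q - p) := by nlinarith
        nlinarith [mul_le_mul_of_nonneg_left h5 (by positivity : 0 ≤ q ^ 2),
          mul_le_mul_of_nonneg_left hlt hq.le]
      have h4 := mul_le_mul_of_nonneg_left h3 (by linarith : (0 : ℝ) ≤ H)
      have e2 : (H : ℝ) * (2 / p - 2 / q) = 2 * H / p - 2 * H / q := by ring
      rw [e]
      linarith
  rcases n with _ | m
  · simp
  rcases le_total m H with h | h
  · have h3 := h1 m h
    have h4 : √(m : ℝ) ≤ √H := sqrt_le_sqrt (by exact_mod_cast h)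
    linarith [sqrt_nonneg (H : ℝ)]
  · have h3 := h2 m h
    have : 0 ≤ 2 * (H : ℝ) / √m := by positivity
    linarith

lemma abs_le_of_hasSum {F G : ℕ → ℝ} {t C : ℝ} (hF : HasSum F t) (hFG : ∀ n, |F n| ≤ G n)
    (hG : ∀ n, ∑ h ∈ Finset.range n, G h ≤ C) : |t| ≤ C := by
  refine le_of_tendsto (hF.tendsto_sum_nat.abs) (Filter.Eventually.of_forall fun n => ?_)
  exact (Finset.abs_sum_le_sum_abs _ _).trans
    ((Finset.sum_le_sum fun i _ => hFG i).trans (hG n))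

lemma abs_sum_sin_le (g : ℕ → ℝ) (n h : ℕ) (η : ℝ) :
    |∑ i ∈ Finset.range n, sin (2 * π * h * (g i + η))| ≤
      ‖∑ i ∈ Finset.range n, unitExp (-(h * g i))‖ := by
  have e : ∑ i ∈ Finset.range n, sin (2 * π * h * (g i + η)) =
      -(unitExp (-(h * η)) * ∑ i ∈ Finset.range n, unitExp (-(h * g i))).im := by
    rw [Finset.mul_sum, Complex.im_sum, ← Finset.sum_neg_distrib]
    refine Finset.sum_congr rfl fun i _ => ?_
    rw [← unitExp_add, unitExp, Complex.exp_ofReal_mul_I_im, ← sin_neg]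
    congr 1
    ring
  rw [e, abs_neg]
  refine (Complex.abs_im_le_norm _).trans ?_
  rw [norm_mul, norm_unitExp, one_mul]

lemma abs_sum_sawtoothPrim_sub_le {g : ℕ → ℝ} {n H : ℕ} {a b : ℝ} (hH : 1 ≤ H) (ha : 0 ≤ a)
    (hb : 0 ≤ b)
    (hS : ∀ h : ℕ, 1 ≤ h → ‖∑ i ∈ Finset.range n, unitExp (-(h * g i))‖ ≤ a * √h + b / √h)
    (η : ℝ) :
    |∑ i ∈ Finset.range n, (sawtoothPrim (g i + η) - sawtoothPrim (g i + η - 1 / (π * H))) /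
      (1 / (π * H))| ≤ 4 / π * (a * √H + b) := by
  have hp := pi_pos
  have hHr : (1 : ℝ) ≤ H := by exact_mod_cast hH
  set δ : ℝ := 1 / (π * H) with hδ
  have hδ0 : 0 < δ := by positivity
  have hsum : HasSum (fun h : ℕ => ∑ i ∈ Finset.range n,
      (1 / (2 * π ^ 2 * (h : ℝ) ^ 2) * cos (2 * π * h * (g i + η)) -
        1 / (2 * π ^ 2 * (h : ℝ) ^ 2) * cos (2 * π * h * (g i + η - δ))) / δ)
      (∑ i ∈ Finset.range n, (sawtoothPrim (g i + η) - sawtoothPrim (g i + η - δ)) / δ) :=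
    hasSum_sum fun i _ => ((hasSum_sawtoothPrim _).sub (hasSum_sawtoothPrim _)).div_const δ
  refine abs_le_of_hasSum (G := fun h => 1 / π * (a * (min (H : ℝ) h / (h : ℝ) ^ 2 * √h) +
    b * (min ((1 : ℕ) : ℝ) h / (h : ℝ) ^ 2 * √h))) hsum ?_ ?_
  · intro h
    rcases Nat.eq_zero_or_pos h with rfl | hpos
    · simp
    have hhr : (1 : ℝ) ≤ h := by exact_mod_cast hpos
    have e : ∑ i ∈ Finset.range n,
      (1 / (2 * π ^ 2 * (h : ℝ) ^ 2) * cos (2 * π * h * (g i + η)) -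
        1 / (2 * π ^ 2 * (h : ℝ) ^ 2) * cos (2 * π * h * (g i + η - δ))) / δ =
        -(H / (π * (h : ℝ) ^ 2)) * sin (π * h * δ) *
          ∑ i ∈ Finset.range n, sin (2 * π * h * (g i + (η - δ / 2))) := by
      rw [Finset.mul_sum]
      refine Finset.sum_congr rfl fun i _ => ?_
      rw [← mul_sub, cos_sub_cos]
      have e1 : (2 * π * h * (g i + η) + 2 * π * h * (g i + η - δ)) / 2 =
        2 * π * h * (g i + (η - δ / 2)) := by ring
      have e2 : (2 * π * h * (g i + η) - 2 * π * h * (g i + η - δ)) / 2 = π * h * δ := by ring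
      rw [e1, e2, hδ]
      field_simp
    have hsin : H * |sin (π * h * δ)| ≤ min (H : ℝ) h := by
      refine le_min ?_ ?_
      · have := abs_sin_le_one (π * h * δ)
        nlinarith
      · have h1 : |sin (π * h * δ)| ≤ |π * h * δ| := abs_sin_le_abs
        rw [abs_of_nonneg (by positivity : 0 ≤ π * h * δ)] at h1
        have h2 : (H : ℝ) * (π * h * δ) = h := by rw [hδ]; field_simp
        have := mul_le_mul_of_nonneg_left h1 (by linarith : (0 : ℝ) ≤ H)
        linarith
    have hq : 0 < √(h : ℝ) := sqrt_pos.2 (by linarith)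
    have hq2 : √(h : ℝ) ^ 2 = h := sq_sqrt (by linarith)
    have hS' := (abs_sum_sin_le g n h (η - δ / 2)).trans (hS h hpos)
    have hm0 : 0 ≤ min (H : ℝ) h := le_min (by linarith) (by linarith)
    rw [e, abs_mul, abs_mul, abs_neg, abs_of_pos (by positivity : 0 < H / (π * (h : ℝ) ^ 2))]
    have hm1 : min (H : ℝ) h ≤ h := min_le_right _ _
    rw [min_eq_left (by exact_mod_cast hhr : ((1 : ℕ) : ℝ) ≤ h)]
    calc H / (π * (h : ℝ) ^ 2) * |sin (π * h * δ)| *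
          |∑ i ∈ Finset.range n, sin (2 * π * h * (g i + (η - δ / 2)))|
        = (H * |sin (π * h * δ)|) * |∑ i ∈ Finset.range n,
          sin (2 * π * h * (g i + (η - δ / 2)))| / (π * (h : ℝ) ^ 2) := by ring
      _ ≤ min (H : ℝ) h * (a * √h + b / √h) / (π * (h : ℝ) ^ 2) := by gcongr
      _ = 1 / π * (a * (min (H : ℝ) h / (h : ℝ) ^ 2 * √h) +
          b * (min (H : ℝ) h / ((h : ℝ) ^ 2 * √h))) := by field_simp
      _ ≤ 1 / π * (a * (min (H : ℝ) h / (h : ℝ) ^ 2 * √h) +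
          b * (h / ((h : ℝ) ^ 2 * √h))) := by gcongr
      _ = _ := by
        congr 3
        push_cast
        field_simp
        exact hq2.symm
  · intro N
    have h1 := sum_min_div_sq_mul_sqrt_le hH N
    have h2 := sum_min_div_sq_mul_sqrt_le le_rfl N
    rw [← Finset.mul_sum, Finset.sum_add_distrib, ← Finset.mul_sum, ← Finset.mul_sum]
    have h1' := mul_le_mul_of_nonneg_left h1 ha
    have h2' := mul_le_mul_of_nonneg_left h2 hb
    rw [Nat.cast_one, sqrt_one] at h2'
    have e : 4 / π * (a * √H + b) = 1 / π * (a * (4 * √H) + b * (4 * 1)) := by ring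
    rw [e, Nat.cast_one]
    have : 0 ≤ 1 / π := by positivity
    gcongr

lemma abs_sum_sawtooth_le_of_exp {g : ℕ → ℝ} {n H : ℕ} {a b : ℝ} (hH : 1 ≤ H) (ha : 0 ≤ a)
    (hb : 0 ≤ b)
    (hS : ∀ h : ℕ, 1 ≤ h → ‖∑ i ∈ Finset.range n, unitExp (-(h * g i))‖ ≤ a * √h + b / √h) :
    |∑ i ∈ Finset.range n, sawtooth (g i)| ≤ n / (2 * π * H) + 4 / π * (a * √H + b) := by
  have hp := pi_gt_three
  have hHr : (1 : ℝ) ≤ H := by exact_mod_cast hH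
  have hδ0 : 0 < 1 / (π * H) := by positivity
  have hδ1 : 1 / (π * H) ≤ 1 := by
    rw [div_le_one (by positivity)]; nlinarith
  have k1 := abs_le.1 (abs_sum_sawtoothPrim_sub_le hH ha hb hS 0)
  have k2 := abs_le.1 (abs_sum_sawtoothPrim_sub_le hH ha hb hS (1 / (π * H)))
  simp only [add_zero, add_sub_cancel_right] at k1 k2
  have e : (n : ℝ) / (2 * π * H) = ∑ i ∈ Finset.range n, (1 / (π * H)) / 2 := by
    rw [Finset.sum_const, Finset.card_range, nsmul_eq_mul]; field_simp
  have u1 := Finset.sum_le_sum fun i (_ : i ∈ Finset.range n) => sawtooth_le hδ0 hδ1 (g i)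
  have u2 := Finset.sum_le_sum fun i (_ : i ∈ Finset.range n) => le_sawtooth hδ0 hδ1 (g i)
  rw [Finset.sum_add_distrib, ← e] at u1
  rw [Finset.sum_sub_distrib, ← e] at u2
  rw [abs_le]
  constructor <;> linarith

/-- A sawtooth sum along a sequence whose second differences have size about `y ^ 3`. -/
lemma abs_sum_sawtooth_le {g : ℕ → ℝ} {n : ℕ} {y : ℝ} (hy : 0 < y) (hy1 : y ≤ 1 / 10)
    (hlo : ∀ i, i + 2 < n → y ^ 3 ≤ -(g (i + 2) - 2 * g (i + 1) + g i))
    (hhi : ∀ i, i + 2 < n → -(g (i + 2) - 2 * g (i + 1) + g i) ≤ 2 * √2 * y ^ 3) :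
    |∑ i ∈ Finset.range n, sawtooth (g i)| ≤ 6 * y * n + 9 / (y * √y) := by
  have hn : (0 : ℝ) ≤ n := Nat.cast_nonneg n
  have hr : 0 < √y := sqrt_pos.2 hy
  have hr2 : √y ^ 2 = y := sq_sqrt hy.le
  have hsq : ∀ h : ℕ, √(h * y ^ 3) = √h * (y * √y) := by
    intro h
    rw [sqrt_mul (Nat.cast_nonneg _), show y ^ 3 = y ^ 2 * y by ring, sqrt_mul (by positivity),
      sqrt_sq hy.le]
  set H := ⌊1 / (10 * y)⌋₊ with hHdef
  have h1 : 1 ≤ 1 / (10 * y) := by rw [le_div_iff₀ (by positivity)]; linarith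
  have hH : 1 ≤ H := Nat.le_floor (by exact_mod_cast h1)
  have hHr : (1 : ℝ) ≤ H := by exact_mod_cast hH
  have hz1 : H * y ≤ 1 / 10 := by
    have := Nat.floor_le (by linarith : 0 ≤ 1 / (10 * y))
    rw [← hHdef, le_div_iff₀ (by positivity)] at this
    linarith
  have hz2 : 1 / 20 ≤ H * y := by
    have := Nat.lt_floor_add_one (1 / (10 * y))
    rw [← hHdef, div_lt_iff₀ (by positivity)] at this
    nlinarith
  have key := abs_sum_sawtooth_le_of_exp (g := g) (n := n) (H := H) (a := 8.7 * (n * (y * √y)))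
    (b := 7 / (y * √y)) hH (by positivity) (by positivity) ?_
  · refine key.trans ?_
    have hp := pi_gt_d2
    have hp0 := pi_pos
    set s := √(H * y) with hs
    have hs2 : s ^ 2 = H * y := sq_sqrt (by linarith)
    have hs0 : 0 < s := sqrt_pos.2 (by linarith)
    have hsl : 0.2236 ≤ s := by
      rw [hs]; apply le_sqrt_of_sq_le; norm_num; linarith
    have hsu : s ≤ 0.3163 := by
      rw [hs, sqrt_le_left (by norm_num)]; norm_num; linarith
    have hHs : √(H : ℝ) * √y = s := by rw [hs, sqrt_mul (by linarith)]
    have e : (n : ℝ) / (2 * π * H) + 4 / π * (8.7 * (n * (y * √y)) * √H + 7 / (y * √y)) =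
        y * n * (1 / (2 * π * s ^ 2) + 34.8 * s / π) + (28 / π) / (y * √y) := by
      rw [hs2, ← hHs]
      field_simp
      ring
    rw [e]
    have b1 : 28 / π ≤ 9 := by rw [div_le_iff₀ hp0]; linarith
    have b2 : 1 / (2 * π * s ^ 2) + 34.8 * s / π ≤ 6 := by
      rw [div_add_div _ _ (by positivity) (by positivity), div_le_iff₀ (by positivity)]
      have c : 1 + 69.6 * s ^ 3 ≤ 37.68 * s ^ 2 := by
        nlinarith [mul_nonneg (sub_nonneg.2 hsl) (sub_nonneg.2 hsu),
          mul_nonneg hs0.le (mul_nonneg (sub_nonneg.2 hsl) (sub_nonneg.2 hsu))]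
      have c2 : 37.68 * s ^ 2 ≤ 12 * π * s ^ 2 := by nlinarith [sq_nonneg s]
      nlinarith
    have b3 : y * n * (1 / (2 * π * s ^ 2) + 34.8 * s / π) ≤ y * n * 6 := by gcongr
    have b4 : (28 / π) / (y * √y) ≤ 9 / (y * √y) := by gcongr
    linarith
  · intro h hh
    have hhr : (0 : ℝ) < h := by exact_mod_cast hh
    have := norm_sum_unitExp_le_sqrt (f := fun i => -(h * g i)) (n := n) (μ := h * y ^ 3)
      (by positivity) ?_ ?_
    · refine this.trans_eq ?_
      rw [hsq]
      have : 0 < √(h : ℝ) := sqrt_pos.2 hhr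
      field_simp
    · intro i hi
      have := mul_le_mul_of_nonneg_left (hlo i hi) hhr.le
      linarith
    · intro i hi
      have := mul_le_mul_of_nonneg_left (hhi i hi) hhr.le
      linarith

lemma exists_second_diff_eq {φ φ' φ'' : ℝ → ℝ} {a : ℝ}
    (h1 : ∀ t ∈ Set.Icc a (a + 2), HasDerivAt φ (φ' t) t)
    (h2 : ∀ t ∈ Set.Icc a (a + 2), HasDerivAt φ' (φ'' t) t) :
    ∃ η ∈ Set.Icc a (a + 2), φ (a + 2) - 2 * φ (a + 1) + φ a = φ'' η := by
  have hd : ∀ t ∈ Set.Icc a (a + 1),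
      HasDerivAt (fun s => φ (s + 1) - φ s) (φ' (t + 1) - φ' t) t := by
    intro t ht
    refine HasDerivAt.sub ?_ (h1 t ⟨ht.1, by linarith [ht.2]⟩)
    exact (h1 (t + 1) ⟨by linarith [ht.1], by linarith [ht.2]⟩).comp_add_const t 1
  obtain ⟨ξ, hξ, e1⟩ := exists_hasDerivAt_eq_slope (fun s => φ (s + 1) - φ s)
    (fun t => φ' (t + 1) - φ' t) (by linarith : a < a + 1)
    (fun t ht => (hd t ht).continuousAt.continuousWithinAt)
    (fun t ht => hd t (Set.Ioo_subset_Icc_self ht))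
  have hsub : ∀ t ∈ Set.Icc ξ (ξ + 1), t ∈ Set.Icc a (a + 2) := fun t ht =>
    ⟨by linarith [ht.1, hξ.1], by linarith [ht.2, hξ.2]⟩
  obtain ⟨η, hη, e2⟩ := exists_hasDerivAt_eq_slope φ' φ'' (by linarith : ξ < ξ + 1)
    (fun t ht => (h2 t (hsub t ht)).continuousAt.continuousWithinAt)
    (fun t ht => h2 t (hsub t (Set.Ioo_subset_Icc_self ht)))
  refine ⟨η, hsub η (Set.Ioo_subset_Icc_self hη), ?_⟩
  rw [e2]
  simp only [add_sub_cancel_left, div_one] at e1 ⊢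
  rw [e1, show a + 1 + 1 = a + 2 by ring]
  ring

lemma second_diff_sqrt_sub_sq {N S a : ℝ} (hS : 0 < S) (ha : 0 ≤ a)
    (h1 : N ^ 2 - a ^ 2 ≤ S ^ 2) (h2 : S ^ 2 / 2 ≤ N ^ 2 - (a + 2) ^ 2) :
    N ^ 2 / S ^ 3 ≤ -(√(N ^ 2 - (a + 2) ^ 2) - 2 * √(N ^ 2 - (a + 1) ^ 2) + √(N ^ 2 - a ^ 2)) ∧
    -(√(N ^ 2 - (a + 2) ^ 2) - 2 * √(N ^ 2 - (a + 1) ^ 2) + √(N ^ 2 - a ^ 2)) ≤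
      2 * √2 * (N ^ 2 / S ^ 3) := by
  have hpos : ∀ t ∈ Set.Icc a (a + 2), S ^ 2 / 2 ≤ N ^ 2 - t ^ 2 ∧ N ^ 2 - t ^ 2 ≤ S ^ 2 := by
    intro t ht
    have := ht.1
    have := ht.2
    constructor <;> nlinarith
  have hS2 : 0 < S ^ 2 / 2 := by positivity
  obtain ⟨η, hη, e⟩ := exists_second_diff_eq (a := a) (φ := fun t => √(N ^ 2 - t ^ 2))
    (φ' := fun t => -t / √(N ^ 2 - t ^ 2)) (φ'' := fun t => -(N ^ 2 / √(N ^ 2 - t ^ 2) ^ 3))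
    (by
      intro t ht
      have h := (hpos t ht).1
      have hd : HasDerivAt (fun t => N ^ 2 - t ^ 2) (-(2 * t)) t := by
        simpa using (hasDerivAt_pow 2 t).const_sub (N ^ 2)
      convert hd.sqrt (by linarith) using 1
      field_simp)
    (by
      intro t ht
      have h := (hpos t ht).1
      have hs : 0 < √(N ^ 2 - t ^ 2) := sqrt_pos.2 (by linarith)
      have hs2 : √(N ^ 2 - t ^ 2) ^ 2 = N ^ 2 - t ^ 2 := sq_sqrt (by linarith)
      have hd : HasDerivAt (fun t => N ^ 2 - t ^ 2) (-(2 * t)) t := by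
        simpa using (hasDerivAt_pow 2 t).const_sub (N ^ 2)
      refine ((hasDerivAt_id t).neg.div (hd.sqrt (by linarith)) hs.ne').congr_deriv ?_
      simp only [Pi.neg_apply, id]
      field_simp
      linear_combination -hs2)
  obtain ⟨hl, hu⟩ := hpos η hη
  rw [e, neg_neg]
  have hr : 0 < √2 := sqrt_pos.2 (by norm_num)
  have hr2 : √2 ^ 2 = 2 := sq_sqrt (by norm_num)
  have hs : 0 < √(N ^ 2 - η ^ 2) := sqrt_pos.2 (by linarith)
  have hsS : √(N ^ 2 - η ^ 2) ≤ S := by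
    rw [sqrt_le_left hS.le]; exact hu
  have hSs : S / √2 ≤ √(N ^ 2 - η ^ 2) := by
    apply le_sqrt_of_sq_le
    rw [div_pow, hr2]; exact hl
  constructor
  · gcongr
  · have e2 : 2 * √2 * (N ^ 2 / S ^ 3) = N ^ 2 / (S / √2) ^ 3 := by
      field_simp
      linear_combination -N ^ 2 * hr2
    rw [e2]
    gcongr

noncomputable def ellipseBranch (N c β t : ℝ) : ℝ := (β * t + √(N ^ 2 - t ^ 2)) / c

lemma abs_sum_sawtooth_ellipseBranch_piece {N c β S y : ℝ} {A B : ℕ} (hc : 0 < c) (hS : 0 < S)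
    (hy : 0 < y) (hy1 : y ≤ 1 / 10) (hyS : N ^ 2 / S ^ 3 = c * y ^ 3) (hAB : A ≤ B)
    (hA : ∀ m : ℕ, A ≤ m → N ^ 2 - (m : ℝ) ^ 2 ≤ S ^ 2)
    (hB : ∀ m : ℕ, m < B → S ^ 2 / 2 ≤ N ^ 2 - (m : ℝ) ^ 2) :
    |∑ m ∈ Finset.Ico A B, sawtooth (ellipseBranch N c β m)| ≤
      6 * y * (B - A) + 9 / (y * √y) := by
  have hcast : ((B - A : ℕ) : ℝ) = B - A := Nat.cast_sub hAB
  rw [Finset.sum_Ico_eq_sum_range, ← hcast]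
  have key : ∀ i, i + 2 < B - A →
      y ^ 3 ≤ -(ellipseBranch N c β ((A + (i + 2) : ℕ) : ℝ) -
        2 * ellipseBranch N c β ((A + (i + 1) : ℕ) : ℝ) + ellipseBranch N c β ((A + i : ℕ) : ℝ)) ∧
      -(ellipseBranch N c β ((A + (i + 2) : ℕ) : ℝ) -
        2 * ellipseBranch N c β ((A + (i + 1) : ℕ) : ℝ) + ellipseBranch N c β ((A + i : ℕ) : ℝ)) ≤
        2 * √2 * y ^ 3 := by
    intro i hi
    have h1 := hA (A + i) (by omega)
    have h2 := hB (A + (i + 2)) (by omega)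
    have c1 : ((A + (i + 2) : ℕ) : ℝ) = ((A + i : ℕ) : ℝ) + 2 := by push_cast; ring
    have c2 : ((A + (i + 1) : ℕ) : ℝ) = ((A + i : ℕ) : ℝ) + 1 := by push_cast; ring
    rw [c1] at h2 ⊢
    rw [c2]
    obtain ⟨k1, k2⟩ := second_diff_sqrt_sub_sq hS (Nat.cast_nonneg _) h1 h2
    rw [hyS] at k1 k2
    set a : ℝ := ((A + i : ℕ) : ℝ)
    have e : -(ellipseBranch N c β (a + 2) - 2 * ellipseBranch N c β (a + 1) +
        ellipseBranch N c β a) =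
        -(√(N ^ 2 - (a + 2) ^ 2) - 2 * √(N ^ 2 - (a + 1) ^ 2) + √(N ^ 2 - a ^ 2)) / c := by
      simp only [ellipseBranch]; ring
    rw [e, le_div_iff₀ hc, div_le_iff₀ hc]
    constructor <;> linarith
  exact abs_sum_sawtooth_le hy hy1 (fun i hi => (key i hi).1) (fun i hi => (key i hi).2)

lemma abs_sum_sawtooth_le_card (S : Finset ℕ) (g : ℕ → ℝ) :
    |∑ i ∈ S, sawtooth (g i)| ≤ S.card / 2 := by
  refine (Finset.abs_sum_le_sum_abs _ _).trans ?_
  refine (Finset.sum_le_sum fun i _ => abs_sawtooth_le (g i)).trans_eq ?_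
  rw [Finset.sum_const, nsmul_eq_mul]
  ring

/-- The first integer `m` with `N ^ 2 - m ^ 2 ≤ N ^ 2 / 2 ^ j`. -/
noncomputable def dyadicCut (N : ℝ) (j : ℕ) : ℕ := ⌈N * √(1 - 1 / 2 ^ j)⌉₊

lemma one_sub_inv_two_pow_nonneg (j : ℕ) : 0 ≤ 1 - 1 / (2 : ℝ) ^ j := by
  have : 1 / (2 : ℝ) ^ j ≤ 1 := by
    rw [div_le_one (by positivity)]; exact one_le_pow₀ (by norm_num)
  linarith

lemma dyadicCut_mono {N : ℝ} (hN : 0 ≤ N) (j : ℕ) : dyadicCut N j ≤ dyadicCut N (j + 1) := by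
  refine Nat.ceil_mono (mul_le_mul_of_nonneg_left (sqrt_le_sqrt ?_) hN)
  have : 1 / (2 : ℝ) ^ (j + 1) ≤ 1 / 2 ^ j :=
    one_div_le_one_div_of_le (by positivity) (pow_le_pow_right₀ (by norm_num) (by omega))
  linarith

lemma sq_sub_le_of_dyadicCut_le {N : ℝ} (hN : 0 ≤ N) {j m : ℕ} (h : dyadicCut N j ≤ m) :
    N ^ 2 - (m : ℝ) ^ 2 ≤ N ^ 2 / 2 ^ j := by
  have h1 : N * √(1 - 1 / 2 ^ j) ≤ m := Nat.ceil_le.1 h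
  have h2 := pow_le_pow_left₀ (by positivity) h1 2
  rw [mul_pow, sq_sqrt (one_sub_inv_two_pow_nonneg j)] at h2
  have e : N ^ 2 * (1 - 1 / 2 ^ j) = N ^ 2 - N ^ 2 / 2 ^ j := by ring
  linarith

lemma le_sq_sub_of_lt_dyadicCut {N : ℝ} {j m : ℕ} (h : m < dyadicCut N j) :
    N ^ 2 / 2 ^ j ≤ N ^ 2 - (m : ℝ) ^ 2 := by
  have h1 : (m : ℝ) < N * √(1 - 1 / 2 ^ j) := Nat.lt_ceil.1 h
  have h2 := pow_le_pow_left₀ (Nat.cast_nonneg m) h1.le 2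
  rw [mul_pow, sq_sqrt (one_sub_inv_two_pow_nonneg j)] at h2
  have e : N ^ 2 * (1 - 1 / 2 ^ j) = N ^ 2 - N ^ 2 / 2 ^ j := by ring
  linarith

lemma dyadicCut_succ_sub_le {N : ℝ} (hN : 0 ≤ N) (j : ℕ) :
    (dyadicCut N (j + 1) : ℝ) - dyadicCut N j ≤
      N * (√(1 - 1 / 2 ^ (j + 1)) - √(1 - 1 / 2 ^ j)) + 1 := by
  have h1 : (dyadicCut N (j + 1) : ℝ) < N * √(1 - 1 / 2 ^ (j + 1)) + 1 :=
    Nat.ceil_lt_add_one (by positivity)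
  have h2 : N * √(1 - 1 / 2 ^ j) ≤ dyadicCut N j := Nat.le_ceil _
  linarith

lemma two_pow_eq_sqrt_two_pow_sq (j : ℕ) : (2 : ℝ) ^ j = (√2 ^ j) ^ 2 := by
  rw [← pow_mul, mul_comm, pow_mul, sq_sqrt (by norm_num)]

lemma abs_sum_sawtooth_ellipseBranch_dyadic {N c β y : ℝ} (hN : 0 < N) (hc : 0 < c) (hy : 0 < y)
    (hyN : y ^ 3 * (c * N) = 1) (j : ℕ) (hj : y * √2 ^ j ≤ 1 / 10) :
    |∑ m ∈ Finset.Ico (dyadicCut N j) (dyadicCut N (j + 1)), sawtooth (ellipseBranch N c β m)| ≤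
      6 * (N * y) * (√2 ^ j * (√(1 - 1 / 2 ^ (j + 1)) - √(1 - 1 / 2 ^ j))) +
        10 / (y * √y) * (1 / √2) ^ j := by
  have hr : 0 < √2 := sqrt_pos.2 (by norm_num)
  have hr1 : 1 ≤ √2 := by rw [one_le_sqrt]; norm_num
  have hR : 0 < √2 ^ j := by positivity
  have hR1 : 1 ≤ √2 ^ j := one_le_pow₀ hr1
  have hRR := two_pow_eq_sqrt_two_pow_sq j
  have hs : 0 < √y := sqrt_pos.2 hy
  set R := √2 ^ j with hRdef
  have hY : 0 < y * R := by positivity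
  have key := abs_sum_sawtooth_ellipseBranch_piece (N := N) (β := β) (S := N / R) (y := y * R)
    (A := dyadicCut N j) (B := dyadicCut N (j + 1)) hc (by positivity) hY hj
    (by
      have : c = 1 / (y ^ 3 * N) := by
        field_simp; linear_combination hyN
      rw [this]; field_simp)
    (dyadicCut_mono hN.le j)
    (fun m hm => by
      rw [div_pow, ← hRR]; exact sq_sub_le_of_dyadicCut_le hN.le hm)
    (fun m hm => by
      have := le_sq_sub_of_lt_dyadicCut hm
      rw [div_pow, ← hRR, div_div, ← pow_succ]; exact this)
  refine key.trans ?_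
  have h1 := mul_le_mul_of_nonneg_left (dyadicCut_succ_sub_le hN.le j)
    (by positivity : 0 ≤ 6 * (y * R))
  have hsY : √y ≤ √(y * R) := sqrt_le_sqrt (by nlinarith)
  have hsY1 : √(y * R) ≤ 1 := Real.sqrt_le_one.2 (by linarith)
  have hsY0 : 0 < √(y * R) := sqrt_pos.2 hY
  have h2 : 6 * (y * R) ≤ 1 / (y * R * √(y * R)) := by
    rw [le_div_iff₀ (by positivity)]
    nlinarith [mul_pos hY hsY0]
  have h3 : 1 / (y * R * √(y * R)) ≤ 1 / (y * √y) * (1 / √2) ^ j := by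
    rw [one_div_pow, ← hRdef, one_div_mul_one_div]
    apply one_div_le_one_div_of_le (by positivity)
    nlinarith [mul_pos hy hR]
  have e3 : 10 / (y * √y) * (1 / √2) ^ j = 10 * (1 / (y * √y) * (1 / √2) ^ j) := by ring
  have e4 : 9 / (y * R * √(y * R)) = 9 * (1 / (y * R * √(y * R))) := by ring
  rw [e3, e4]
  linarith

lemma dyadic_sqrt_diff_le (j : ℕ) :
    √2 ^ (j + 1) * (√(1 - 1 / 2 ^ (j + 1 + 1)) - √(1 - 1 / 2 ^ (j + 1))) ≤
      0.354 * (1 / √2) ^ (j + 1) := by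
  have hr : 0 < √2 := sqrt_pos.2 (by norm_num)
  have hRR := two_pow_eq_sqrt_two_pow_sq (j + 1)
  have hR : 0 < √2 ^ (j + 1) := by positivity
  have h2 : (2 : ℝ) ≤ 2 ^ (j + 1) := by
    rw [pow_succ]; have : (1 : ℝ) ≤ 2 ^ j := one_le_pow₀ (by norm_num)
    linarith
  rw [pow_succ 2 (j + 1), one_div_pow]
  set R := √2 ^ (j + 1)
  rw [hRR] at h2 ⊢
  have hv : 1 / R ^ 2 ≤ 1 / 2 := one_div_le_one_div_of_le (by norm_num) h2
  have hv0 : 0 < 1 / R ^ 2 := by positivity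
  have e : 1 / (R ^ 2 * 2) = 1 / R ^ 2 / 2 := by field_simp
  rw [e]
  set v := 1 / R ^ 2 with hvdef
  have hp : 0.707 ≤ √(1 - v / 2) := by apply le_sqrt_of_sq_le; norm_num; linarith
  have hq : 0.707 ≤ √(1 - v) := by apply le_sqrt_of_sq_le; norm_num; linarith
  have hp2 : √(1 - v / 2) ^ 2 = 1 - v / 2 := sq_sqrt (by linarith)
  have hq2 : √(1 - v) ^ 2 = 1 - v := sq_sqrt (by linarith)
  have hpq : √(1 - v) ≤ √(1 - v / 2) := sqrt_le_sqrt (by linarith)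
  have h : √(1 - v / 2) - √(1 - v) ≤ 0.354 * v := by nlinarith
  have h3 := mul_le_mul_of_nonneg_left h hR.le
  refine h3.trans_eq ?_
  rw [hvdef]; field_simp

lemma abs_sum_sawtooth_ellipseBranch_range {N c β y : ℝ} (hN : 0 < N) (hc : 0 < c) (hy : 0 < y)
    (hyN : y ^ 3 * (c * N) = 1) (J : ℕ) (hJ : ∀ j ≤ J, y * √2 ^ j ≤ 1 / 10) :
    |∑ m ∈ Finset.range (dyadicCut N (J + 1)), sawtooth (ellipseBranch N c β m)| ≤
      6 * (N * y) * (1.58 - 1.22 * (1 / √2) ^ (J + 1)) +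
        35 / (y * √y) * (1 - (1 / √2) ^ (J + 1)) := by
  have hr : 0 < √2 := sqrt_pos.2 (by norm_num)
  have hr2 : √2 ^ 2 = 2 := sq_sqrt (by norm_num)
  have hs : 0 < √y := sqrt_pos.2 hy
  have hW : 0 < 1 / (y * √y) := by positivity
  have hX : 0 < N * y := by positivity
  have hρl : 0.707 ≤ 1 / √2 := by
    rw [le_div_iff₀ hr]; nlinarith
  have hρu : 1 / √2 ≤ 0.7072 := by
    rw [div_le_iff₀ hr]; nlinarith
  have hr' : √2 = 2 * (1 / √2) := by field_simp; exact hr2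
  have e10 : 10 / (y * √y) = 10 * (1 / (y * √y)) := by ring
  have e35 : 35 / (y * √y) = 35 * (1 / (y * √y)) := by ring
  induction J with
  | zero =>
    have h := abs_sum_sawtooth_ellipseBranch_dyadic (β := β) hN hc hy hyN 0 (hJ 0 le_rfl)
    have h0 : dyadicCut N 0 = 0 := by simp [dyadicCut]
    rw [h0, ← Finset.range_eq_Ico] at h
    refine h.trans ?_
    have e : √(1 - 1 / 2 ^ (0 + 1)) = 1 / √2 := by
      rw [← sqrt_one, ← sqrt_div (by norm_num)]; norm_num
    rw [e, e10, e35]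
    simp only [pow_zero, zero_add, pow_one, one_mul, mul_one, div_one, sub_self, sqrt_zero,
      sub_zero]
    have k1 := mul_le_mul_of_nonneg_left
      (by linarith : 1 / √2 ≤ 1.58 - 1.22 * (1 / √2)) (by positivity : 0 ≤ 6 * (N * y))
    have k2 := mul_le_mul_of_nonneg_left
      (by linarith : 10 ≤ 35 * (1 - 1 / √2)) hW.le
    linarith
  | succ J ih =>
    have h1 := ih fun j hj => hJ j (by omega)
    have h2 := abs_sum_sawtooth_ellipseBranch_dyadic (β := β) hN hc hy hyN (J + 1) (hJ _ le_rfl)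
    rw [← Finset.sum_range_add_sum_Ico _ (dyadicCut_mono hN.le (J + 1))]
    refine (abs_add_le _ _).trans ((add_le_add h1 h2).trans ?_)
    have h3 := mul_le_mul_of_nonneg_left (dyadic_sqrt_diff_le J)
      (by positivity : 0 ≤ 6 * (N * y))
    rw [pow_succ (1 / √2) (J + 1), e10, e35]
    have hP : 0 < (1 / √2) ^ (J + 1) := by positivity
    set P := (1 / √2) ^ (J + 1)
    have k1 := mul_le_mul_of_nonneg_left
      (by nlinarith : 0.354 * P + (1.58 - 1.22 * P) ≤ 1.58 - 1.22 * (P * (1 / √2)))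
      (by positivity : 0 ≤ 6 * (N * y))
    have k2 := mul_le_mul_of_nonneg_left
      (by nlinarith : 10 * P + 35 * (1 - P) ≤ 35 * (1 - P * (1 / √2))) hW.le
    linarith

lemma abs_sum_sawtooth_ellipseBranch_le {N c y : ℝ} (β : ℝ) (hN : 0 < N) (hc : 0 < c) (hy : 0 < y)
    (hyN : y ^ 3 * (c * N) = 1) :
    |∑ m ∈ Finset.range (⌊N⌋₊ + 1), sawtooth (ellipseBranch N c β m)| ≤
      9.48 * (N * y) + 35 / (y * √y) + 1 / 2 := by
  classical
  have hr : 0 < √2 := sqrt_pos.2 (by norm_num)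
  have hr1 : 1 < √2 := by rw [lt_sqrt]; norm_num; norm_num
  have hs : 0 < √y := sqrt_pos.2 hy
  have hX : 0 < N * y := by positivity
  have hW : 0 < 35 / (y * √y) := by positivity
  have hex : ∃ j : ℕ, 1 / 10 < y * √2 ^ j := by
    obtain ⟨j, hj⟩ := pow_unbounded_of_one_lt (1 / 10 / y) hr1
    exact ⟨j, by rwa [div_lt_iff₀' hy] at hj⟩
  set J := Nat.find hex with hJdef
  have hJ : 1 / 10 < y * √2 ^ J := Nat.find_spec hex
  have hlt : ∀ j < J, y * √2 ^ j ≤ 1 / 10 := fun j hj => not_lt.1 (Nat.find_min hex hj)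
  have hcut : dyadicCut N J ≤ ⌊N⌋₊ + 1 := by
    refine Nat.ceil_le.2 ?_
    have h1 : √(1 - 1 / 2 ^ J) ≤ 1 := by
      apply Real.sqrt_le_one.2
      have : 0 < 1 / (2 : ℝ) ^ J := by positivity
      linarith
    have h2 := Nat.lt_floor_add_one N
    push_cast
    nlinarith
  rw [← Finset.sum_range_add_sum_Ico _ hcut]
  have htail : |∑ m ∈ Finset.Ico (dyadicCut N J) (⌊N⌋₊ + 1), sawtooth (ellipseBranch N c β m)| ≤
      5 * (N * y) * (1 / √2) ^ J + 1 / 2 := by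
    refine (abs_sum_sawtooth_le_card _ _).trans ?_
    rw [Nat.card_Ico, Nat.cast_sub hcut]
    have h1 : N * √(1 - 1 / 2 ^ J) ≤ dyadicCut N J := Nat.le_ceil _
    have h2 := Nat.floor_le hN.le
    have h3 : 1 - 1 / 2 ^ J ≤ √(1 - 1 / (2 : ℝ) ^ J) := by
      apply le_sqrt_of_sq_le
      have := one_sub_inv_two_pow_nonneg J
      have : 0 < 1 / (2 : ℝ) ^ J := by positivity
      nlinarith
    have h4 := mul_le_mul_of_nonneg_left h3 hN.le
    have h5 : N * (1 / 2 ^ J) ≤ 10 * (N * y) * (1 / √2) ^ J := by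
      rw [two_pow_eq_sqrt_two_pow_sq, one_div_pow]
      have hR : 0 < √2 ^ J := by positivity
      set R := √2 ^ J
      have e : N * (1 / R ^ 2) = N / R ^ 2 := by ring
      have e2 : 10 * (N * y) * (1 / R) = N * (10 * (y * R)) / R ^ 2 := by field_simp
      rw [e, e2]
      gcongr
      nlinarith
    push_cast
    linarith
  refine (abs_add_le _ _).trans ((add_le_add le_rfl htail).trans ?_)
  rcases Nat.eq_zero_or_pos J with h0 | hpos
  · rw [h0]
    have : dyadicCut N 0 = 0 := by simp [dyadicCut]
    rw [this, Finset.range_zero, Finset.sum_empty, abs_zero, pow_zero]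
    linarith
  · obtain ⟨k, hk⟩ : ∃ k, J = k + 1 := ⟨J - 1, by omega⟩
    have h := abs_sum_sawtooth_ellipseBranch_range (β := β) hN hc hy hyN k
      (fun j hj => hlt j (by omega))
    rw [← hk] at h
    have hP : 0 < (1 / √2) ^ J := by positivity
    have := mul_pos hX hP
    have := mul_pos hW hP
    linarith

lemma continuous_sqrt_sub_sq (N : ℝ) : Continuous fun t : ℝ => √(N ^ 2 - t ^ 2) := by fun_prop

lemma integral_affine (p q u v : ℝ) :
    ∫ t in u..v, (p + q * t) = p * (v - u) + q * ((v ^ 2 - u ^ 2) / 2) := by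
  rw [intervalIntegral.integral_add (by simp) (Continuous.intervalIntegrable (by fun_prop) _ _),
    intervalIntegral.integral_const, intervalIntegral.integral_const_mul, integral_id, smul_eq_mul]
  ring

lemma integral_sqrt_sub_sq {N : ℝ} (hN : 0 < N) :
    ∫ t in (0 : ℝ)..N, √(N ^ 2 - t ^ 2) = π * N ^ 2 / 4 := by
  have h1 : ∫ t in (0 : ℝ)..1, √(1 - t ^ 2) = π / 4 := by
    have hc : Continuous fun t : ℝ => √(1 - t ^ 2) := by fun_prop
    have h := integral_sqrt_one_sub_sq
    rw [← intervalIntegral.integral_add_adjacent_intervals (b := 0)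
      (hc.intervalIntegrable _ _) (hc.intervalIntegrable _ _)] at h
    have h2 : ∫ t in (-1 : ℝ)..0, √(1 - t ^ 2) = ∫ t in (0 : ℝ)..1, √(1 - t ^ 2) := by
      have := intervalIntegral.integral_comp_neg (a := 0) (b := 1) (fun t : ℝ => √(1 - t ^ 2))
      simp only [neg_zero, neg_sq] at this
      exact this.symm
    linarith
  have h2 := intervalIntegral.mul_integral_comp_mul_left (a := 0) (b := 1)
    (f := fun t : ℝ => √(N ^ 2 - t ^ 2)) N
  rw [mul_zero, mul_one] at h2
  rw [← h2]
  have h3 : ∀ t : ℝ, √(N ^ 2 - (N * t) ^ 2) = N * √(1 - t ^ 2) := by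
    intro t
    rw [show N ^ 2 - (N * t) ^ 2 = N ^ 2 * (1 - t ^ 2) by ring, sqrt_mul (by positivity),
      sqrt_sq hN.le]
  simp only [h3]
  rw [intervalIntegral.integral_const_mul, h1]
  ring

lemma sqrt_mul_sqrt_add_mul_le {N s t : ℝ} (hs : s ^ 2 ≤ N ^ 2) (ht : t ^ 2 ≤ N ^ 2) :
    √(N ^ 2 - s ^ 2) * √(N ^ 2 - t ^ 2) + s * t ≤ N ^ 2 := by
  have h1 := sq_sqrt (by linarith : 0 ≤ N ^ 2 - s ^ 2)
  have h2 := sq_sqrt (by linarith : 0 ≤ N ^ 2 - t ^ 2)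
  nlinarith [sq_nonneg (√(N ^ 2 - s ^ 2) - √(N ^ 2 - t ^ 2)), sq_nonneg (s - t)]

lemma integral_sqrt_sub_sq_le {N u v : ℝ} (hu : 0 ≤ u) (huv : u ≤ v) :
    ∫ t in u..v, √(N ^ 2 - t ^ 2) ≤ (v - u) * √(N ^ 2 - u ^ 2) := by
  have h : ∫ t in u..v, √(N ^ 2 - t ^ 2) ≤ ∫ _ in u..v, √(N ^ 2 - u ^ 2) := by
    refine intervalIntegral.integral_mono_on huv
      ((continuous_sqrt_sub_sq N).intervalIntegrable _ _) (by simp) fun t ht => sqrt_le_sqrt ?_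
    nlinarith [ht.1]
  simpa using h

lemma trapezoid_le_integral_sqrt_sub_sq {N u v : ℝ} (hu : 0 ≤ u) (huv : u ≤ v) (hv : v ≤ N) :
    (v - u) * ((√(N ^ 2 - u ^ 2) + √(N ^ 2 - v ^ 2)) / 2) ≤ ∫ t in u..v, √(N ^ 2 - t ^ 2) := by
  rcases huv.eq_or_lt with rfl | hlt
  · simp
  have hu2 : u ^ 2 ≤ N ^ 2 := by nlinarith
  have hv2 : v ^ 2 ≤ N ^ 2 := by nlinarith
  have hcs := sqrt_mul_sqrt_add_mul_le hu2 hv2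
  have e1 := sq_sqrt (by linarith : 0 ≤ N ^ 2 - u ^ 2)
  have e2 := sq_sqrt (by linarith : 0 ≤ N ^ 2 - v ^ 2)
  set p := √(N ^ 2 - u ^ 2)
  set q := √(N ^ 2 - v ^ 2)
  have hd : 0 < v - u := by linarith
  have h : ∫ t in u..v, ((v * p - u * q) / (v - u) + (q - p) / (v - u) * t) ≤
      ∫ t in u..v, √(N ^ 2 - t ^ 2) := by
    refine intervalIntegral.integral_mono_on huv (Continuous.intervalIntegrable (by fun_prop) _ _)
      ((continuous_sqrt_sub_sq N).intervalIntegrable _ _) fun t ht => ?_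
    apply le_sqrt_of_sq_le
    have e : (v * p - u * q) / (v - u) + (q - p) / (v - u) * t =
        ((v - t) * p + (t - u) * q) / (v - u) := by field_simp; ring
    rw [e, div_pow, div_le_iff₀ (by positivity)]
    have hm : 0 ≤ (v - t) * (t - u) := mul_nonneg (by linarith [ht.2]) (by linarith [ht.1])
    have := mul_le_mul_of_nonneg_left hcs hm
    have k1 : ((v - t) * p + (t - u) * q) ^ 2 =
        (v - t) ^ 2 * p ^ 2 + (t - u) ^ 2 * q ^ 2 + 2 * ((v - t) * (t - u) * (p * q)) := by ring
    rw [k1, e1, e2]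
    nlinarith
  rw [integral_affine] at h
  refine le_trans (le_of_eq ?_) h
  field_simp
  ring

lemma integral_sqrt_sub_sq_le_midpoint {N a : ℝ} (h0 : 1 / 2 ≤ a) (h1 : a + 1 / 2 ≤ N) :
    ∫ t in (a - 1 / 2)..(a + 1 / 2), √(N ^ 2 - t ^ 2) ≤ √(N ^ 2 - a ^ 2) := by
  have ha2 : a ^ 2 ≤ N ^ 2 := by nlinarith
  have hpos : 0 < N ^ 2 - a ^ 2 := by nlinarith
  have hp : 0 < √(N ^ 2 - a ^ 2) := sqrt_pos.2 hpos
  have hp2 := sq_sqrt hpos.le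
  have h : ∫ t in (a - 1 / 2)..(a + 1 / 2), √(N ^ 2 - t ^ 2) ≤
      ∫ t in (a - 1 / 2)..(a + 1 / 2), (N ^ 2 / √(N ^ 2 - a ^ 2) + -a / √(N ^ 2 - a ^ 2) * t) := by
    refine intervalIntegral.integral_mono_on (by linarith)
      ((continuous_sqrt_sub_sq N).intervalIntegrable _ _)
      (Continuous.intervalIntegrable (by fun_prop) _ _) fun t ht => ?_
    have ht2 : t ^ 2 ≤ N ^ 2 := by nlinarith [ht.1, ht.2]
    have hcs := sqrt_mul_sqrt_add_mul_le ht2 ha2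
    have e : N ^ 2 / √(N ^ 2 - a ^ 2) + -a / √(N ^ 2 - a ^ 2) * t =
      (N ^ 2 - t * a) / √(N ^ 2 - a ^ 2) := by ring
    rw [e, le_div_iff₀ hp]
    linarith
  rw [integral_affine] at h
  refine h.trans_eq ?_
  field_simp
  linear_combination (-8 : ℝ) * hp2

lemma integral_le_sum_sqrt_sub_sq {N : ℝ} (k : ℕ) (hk : k + 1 / 2 ≤ N) :
    ∫ t in (0 : ℝ)..(k + 1 / 2), √(N ^ 2 - t ^ 2) ≤
      ∑ m ∈ Finset.range (k + 1), √(N ^ 2 - (m : ℝ) ^ 2) - N / 2 := by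
  have h_int := (continuous_sqrt_sub_sq N).intervalIntegrable (μ := MeasureTheory.volume)
  induction k with
  | zero =>
    have h := integral_sqrt_sub_sq_le (N := N) (u := 0) (v := 1 / 2) le_rfl (by norm_num)
    have hN : 0 ≤ N := by push_cast at hk; linarith
    have e : √(N ^ 2 - 0 ^ 2) = N := by rw [zero_pow two_ne_zero, sub_zero, sqrt_sq hN]
    simp only [Nat.cast_zero, zero_add, Finset.sum_range_one]
    rw [e] at h ⊢
    linarith
  | succ k ih =>
    push_cast at hk ⊢
    have h1 := ih (by linarith)
    have hk0 : (0 : ℝ) ≤ k := Nat.cast_nonneg k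
    have h2 := integral_sqrt_sub_sq_le_midpoint (a := (k : ℝ) + 1) (N := N) (by linarith) hk
    rw [Finset.sum_range_succ, ← intervalIntegral.integral_add_adjacent_intervals
      (h_int 0 (k + 1 / 2)) (h_int _ _)]
    rw [show (k : ℝ) + 1 - 1 / 2 = k + 1 / 2 by ring] at h2
    push_cast
    linarith

lemma sum_sqrt_sub_sq_le_integral {N : ℝ} (hN : 0 ≤ N) (k : ℕ) (hk : k ≤ N) :
    ∑ m ∈ Finset.range (k + 1), √(N ^ 2 - (m : ℝ) ^ 2) - N / 2 ≤
      (∫ t in (0 : ℝ)..k, √(N ^ 2 - t ^ 2)) + √(N ^ 2 - (k : ℝ) ^ 2) / 2 := by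
  have h_int := (continuous_sqrt_sub_sq N).intervalIntegrable (μ := MeasureTheory.volume)
  induction k with
  | zero =>
    have e : √(N ^ 2 - 0 ^ 2) = N := by rw [zero_pow two_ne_zero, sub_zero, sqrt_sq hN]
    simp only [zero_add, Finset.sum_range_one, Nat.cast_zero, e]
    simp
  | succ k ih =>
    push_cast at hk ⊢
    have h1 := ih (by linarith)
    have hk0 : (0 : ℝ) ≤ k := Nat.cast_nonneg k
    have h2 := trapezoid_le_integral_sqrt_sub_sq (u := (k : ℝ)) (v := k + 1) hk0 (by linarith) hk
    rw [Finset.sum_range_succ, ← intervalIntegral.integral_add_adjacent_intervals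
      (h_int 0 k) (h_int _ _)]
    push_cast
    linarith

/-- Comparison of the sum of the chord lengths of a disc of radius `N` with its area. -/
lemma abs_sum_chords_sub_area_le {N : ℝ} (hN : 0 < N) :
    |4 * ∑ m ∈ Finset.range (⌊N⌋₊ + 1), √(N ^ 2 - (m : ℝ) ^ 2) - 2 * N - π * N ^ 2| ≤
      2 * √N := by
  have h_int := (continuous_sqrt_sub_sq N).intervalIntegrable (μ := MeasureTheory.volume)
  have hI := integral_sqrt_sub_sq hN
  have hM1 := Nat.floor_le hN.le
  have hM2 := Nat.lt_floor_add_one N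
  set M := ⌊N⌋₊ with hM
  have hM0 : (0 : ℝ) ≤ M := Nat.cast_nonneg M
  have hsM : 0 ≤ N ^ 2 - (M : ℝ) ^ 2 := by nlinarith
  rw [abs_le]
  constructor
  · suffices h : -(√N / 2) ≤
        ∑ m ∈ Finset.range (M + 1), √(N ^ 2 - (m : ℝ) ^ 2) - N / 2 - π * N ^ 2 / 4 by linarith
    rw [← hI]
    rcases le_or_gt ((M : ℝ) + 1 / 2) N with h | h
    · have h1 := integral_le_sum_sqrt_sub_sq M h
      have h2 := integral_sqrt_sub_sq_le (N := N) (u := M + 1 / 2) (v := N) (by linarith) h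
      rw [← intervalIntegral.integral_add_adjacent_intervals (h_int 0 (M + 1 / 2)) (h_int _ _)]
      have h3 : √(N ^ 2 - ((M : ℝ) + 1 / 2) ^ 2) ≤ √N := sqrt_le_sqrt (by nlinarith)
      have h4 := sqrt_nonneg (N ^ 2 - ((M : ℝ) + 1 / 2) ^ 2)
      nlinarith
    · rcases Nat.eq_zero_or_pos M with h0 | hpos
      · rw [hI]
        rw [h0] at h ⊢
        have e : √(N ^ 2 - 0 ^ 2) = N := by rw [zero_pow two_ne_zero, sub_zero, sqrt_sq hN.le]
        simp only [zero_add, Finset.sum_range_one, Nat.cast_zero, e] at h ⊢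
        have := pi_lt_four
        have := sqrt_nonneg N
        nlinarith
      · obtain ⟨k, hk⟩ : ∃ k, M = k + 1 := ⟨M - 1, by omega⟩
        have hMk : (M : ℝ) = k + 1 := by rw [hk]; push_cast; ring
        have hk0 : (0 : ℝ) ≤ k := Nat.cast_nonneg k
        have h1 := integral_le_sum_sqrt_sub_sq (N := N) k (by linarith)
        have h2 := integral_sqrt_sub_sq_le (N := N) (u := k + 1 / 2) (v := M) (by linarith)
          (by linarith)
        have h3 := integral_sqrt_sub_sq_le (N := N) (u := M) (v := N) hM0 hM1
        rw [Finset.sum_range_succ,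
          ← intervalIntegral.integral_add_adjacent_intervals (h_int 0 (k + 1 / 2)) (h_int _ _),
          ← intervalIntegral.integral_add_adjacent_intervals (h_int (k + 1 / 2) M) (h_int _ _)]
        rw [← hk] at h1
        have h4 : √(N ^ 2 - ((k : ℝ) + 1 / 2) ^ 2) ≤ √(N ^ 2 - (M : ℝ) ^ 2) + √N := by
          rw [sqrt_le_left (by positivity)]
          have e1 := sq_sqrt hsM
          have e2 := sq_sqrt hN.le
          have e3 : 0 ≤ √(N ^ 2 - (M : ℝ) ^ 2) * √N := by positivity
          nlinarith
        have h5 := sqrt_nonneg (N ^ 2 - (M : ℝ) ^ 2)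
        have h6 : (M : ℝ) - (k + 1 / 2) = 1 / 2 := by rw [hMk]; ring
        rw [h6] at h2
        nlinarith
  · suffices h : ∑ m ∈ Finset.range (M + 1), √(N ^ 2 - (m : ℝ) ^ 2) - N / 2 - π * N ^ 2 / 4 ≤
        √N / 2 by linarith
    rw [← hI]
    have h1 := sum_sqrt_sub_sq_le_integral hN.le M hM1
    have h2 := trapezoid_le_integral_sqrt_sub_sq hM0 hM1 (le_refl N)
    rw [sub_self, sqrt_zero] at h2
    rw [← intervalIntegral.integral_add_adjacent_intervals (h_int 0 M) (h_int _ _)]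
    have h3 : (1 - (N - M)) * √(N ^ 2 - (M : ℝ) ^ 2) ≤ √N := by
      apply le_sqrt_of_sq_le
      rw [mul_pow, sq_sqrt hsM]
      obtain ⟨r, hr⟩ : ∃ r, r = N - M := ⟨_, rfl⟩
      have e : N ^ 2 - (M : ℝ) ^ 2 = r * (2 * N - r) := by rw [hr]; ring
      have hr0 : 0 ≤ r := by linarith
      have hr1 : r ≤ 1 := by linarith
      rw [← hr, e]
      have k1 : r * (1 - r) ^ 2 ≤ 1 / 2 := by nlinarith [sq_nonneg (r - 1 / 2), sq_nonneg (1 - r)]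
      have k2 : 0 ≤ r * (1 - r) ^ 2 := by positivity
      nlinarith
    linarith

lemma sum_Icc_neg_eq_range (F : ℤ → ℝ) (M : ℕ) :
    ∑ m ∈ Finset.Icc (-M : ℤ) M, F m =
      ∑ m ∈ Finset.range (M + 1), (F m + F (-m)) - F 0 := by
  induction M with
  | zero => simp
  | succ k ih =>
    rw [Nat.cast_add, Nat.cast_one, Finset.Icc_succ_succ, Finset.sum_union (by simp),
      Finset.sum_pair (by lia), ih, Finset.sum_range_succ _ (k + 1)]
    push_cast
    ring

lemma card_Icc_neg_ceil_floor {u v : ℝ} (h : 0 ≤ u + v) :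
    ((Finset.Icc ⌈-u⌉ ⌊v⌋).card : ℝ) = u + v - sawtooth u - sawtooth v := by
  have hu := Int.lt_floor_add_one u
  have hv := Int.lt_floor_add_one v
  have h0 : 0 ≤ ⌊v⌋ + 1 + ⌊u⌋ := by
    have : (-1 : ℝ) < ((⌊v⌋ + 1 + ⌊u⌋ : ℤ) : ℝ) := by push_cast; linarith
    have : (-1 : ℤ) < ⌊v⌋ + 1 + ⌊u⌋ := by exact_mod_cast this
    omega
  rw [Int.card_Icc, Int.ceil_neg, sub_neg_eq_add, ← Int.cast_natCast, Int.toNat_of_nonneg h0]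
  simp only [sawtooth, Int.fract]
  push_cast
  ring

lemma ellipseBranch_add_ellipseBranch_neg {N c : ℝ} (β t : ℝ) :
    ellipseBranch N c β t + ellipseBranch N c (-β) t = 2 * √(N ^ 2 - t ^ 2) / c := by
  simp only [ellipseBranch]
  ring

lemma ellipseBranch_neg_arg {N c : ℝ} (β t : ℝ) :
    ellipseBranch N c β (-t) = ellipseBranch N c (-β) t := by
  simp [ellipseBranch]

lemma ellipse_le_iff {a b c : ℝ} (hc : 0 < c) (hdet : a * c - b ^ 2 = 1) {N x : ℝ} (hN : 0 < N)
    (hNx : N ^ 2 = c * x ^ 2) (m n : ℤ) :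
    a * (m : ℝ) ^ 2 + 2 * b * m * n + c * (n : ℝ) ^ 2 ≤ x ^ 2 ↔
      m ∈ Finset.Icc (-⌊N⌋₊ : ℤ) ⌊N⌋₊ ∧
        n ∈ Finset.Icc ⌈-ellipseBranch N c b m⌉ ⌊ellipseBranch N c (-b) m⌋ := by
  have key : a * (m : ℝ) ^ 2 + 2 * b * m * n + c * (n : ℝ) ^ 2 ≤ x ^ 2 ↔
      (c * n + b * m) ^ 2 ≤ N ^ 2 - (m : ℝ) ^ 2 := by
    rw [← mul_le_mul_iff_right₀ hc, ← hNx, le_sub_iff_add_le]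
    have e : c * (a * (m : ℝ) ^ 2 + 2 * b * m * n + c * (n : ℝ) ^ 2) =
        (c * n + b * m) ^ 2 + (m : ℝ) ^ 2 := by linear_combination (m : ℝ) ^ 2 * hdet
    rw [e]
  have hm : m ∈ Finset.Icc (-⌊N⌋₊ : ℤ) ⌊N⌋₊ ↔ 0 ≤ N ^ 2 - (m : ℝ) ^ 2 := by
    rw [sub_nonneg, sq_le_sq, abs_of_pos hN, Finset.mem_Icc, ← abs_le,
      Int.natCast_floor_eq_floor hN.le, Int.le_floor, Int.cast_abs]
  rw [key, hm, Finset.mem_Icc, Int.ceil_le, Int.le_floor, ellipseBranch, ellipseBranch,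
    le_div_iff₀ hc, ← neg_div, div_le_iff₀ hc]
  constructor
  · intro h
    have h0 := (sq_nonneg _).trans h
    have := abs_le.1 (abs_le_sqrt h)
    exact ⟨h0, by linarith [this.1], by linarith [this.2]⟩
  · rintro ⟨h0, h1, h2⟩
    rw [← sqrt_le_sqrt_iff h0, sqrt_sq_eq_abs, abs_le]
    constructor <;> linarith

/-- The number of lattice points of an ellipse as a sum over its vertical chords. -/
lemma ncard_ellipse_eq {a b c : ℝ} (hc : 0 < c) (hdet : a * c - b ^ 2 = 1) {N x : ℝ} (hN : 0 < N)
    (hNx : N ^ 2 = c * x ^ 2) :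
    ({q : ℤ × ℤ | a * (q.1 : ℝ) ^ 2 + 2 * b * (q.1 : ℝ) * (q.2 : ℝ) +
      c * (q.2 : ℝ) ^ 2 ≤ x ^ 2}.ncard : ℝ) =
      (4 * ∑ m ∈ Finset.range (⌊N⌋₊ + 1), √(N ^ 2 - (m : ℝ) ^ 2) - 2 * N) / c
      - 2 * (∑ m ∈ Finset.range (⌊N⌋₊ + 1), sawtooth (ellipseBranch N c b m)
      + ∑ m ∈ Finset.range (⌊N⌋₊ + 1), sawtooth (ellipseBranch N c (-b) m)
      - sawtooth (N / c)) := by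
  have hset : {q : ℤ × ℤ | a * (q.1 : ℝ) ^ 2 + 2 * b * (q.1 : ℝ) * (q.2 : ℝ) +
      c * (q.2 : ℝ) ^ 2 ≤ x ^ 2} = (((Finset.Icc (-⌊N⌋₊ : ℤ) ⌊N⌋₊).sigma fun m =>
        Finset.Icc ⌈-ellipseBranch N c b m⌉ ⌊ellipseBranch N c (-b) m⌋).map
        (Equiv.sigmaEquivProd ℤ ℤ).toEmbedding : Finset (ℤ × ℤ)) := by
    ext ⟨m, n⟩
    simp only [Set.mem_ofPred_eq, SetLike.mem_coe, Finset.mem_map_equiv, Finset.mem_sigma]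
    exact ellipse_le_iff hc hdet hN hNx m n
  have hcard : ∀ m : ℤ,
      ((Finset.Icc ⌈-ellipseBranch N c b m⌉ ⌊ellipseBranch N c (-b) m⌋).card : ℝ) =
        2 * √(N ^ 2 - (m : ℝ) ^ 2) / c - sawtooth (ellipseBranch N c b m)
        - sawtooth (ellipseBranch N c (-b) m) := by
    intro m
    rw [card_Icc_neg_ceil_floor, ellipseBranch_add_ellipseBranch_neg]
    rw [ellipseBranch_add_ellipseBranch_neg]
    positivity
  have h0 : ∀ β, ellipseBranch N c β 0 = N / c := by
    intro β
    simp [ellipseBranch, sqrt_sq hN.le]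
  rw [hset, Set.ncard_coe_finset, Finset.card_map, Finset.card_sigma, Nat.cast_sum]
  simp only [hcard]
  rw [sum_Icc_neg_eq_range]
  simp only [Int.cast_neg, Int.cast_natCast, Int.cast_zero, ellipseBranch_neg_arg, neg_neg, neg_sq,
    h0, Finset.sum_add_distrib, Finset.sum_sub_distrib, ← Finset.sum_div, ← Finset.mul_sum]
  rw [zero_pow two_ne_zero, sub_zero, sqrt_sq hN.le]
  ring

/-- Krätzel's bound for an ellipse of area `π`, with smaller constants. -/
lemma abs_ncard_ellipse_sub_area_le {a b c : ℝ} (ha : 0 < a) (hdet : a * c - b ^ 2 = 1) {x : ℝ}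
    (hx : 0 < x) :
    |({q : ℤ × ℤ | a * (q.1 : ℝ) ^ 2 + 2 * b * (q.1 : ℝ) * (q.2 : ℝ) +
      c * (q.2 : ℝ) ^ 2 ≤ x ^ 2}.ncard : ℝ) - π * x ^ 2| ≤
      37.92 * x ^ ((2 : ℝ) / 3) +
        (2 * a ^ ((3 : ℝ) / 4) + 140 * c ^ ((3 : ℝ) / 4)) * √x + 3 := by
  have hac : 1 ≤ a * c := by nlinarith [sq_nonneg b]
  have hc : 0 < c := by
    by_contra! h
    nlinarith
  obtain ⟨N, hNdef⟩ : ∃ N, N = √c * x := ⟨_, rfl⟩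
  have hN : 0 < N := by rw [hNdef]; positivity
  have hNx : N ^ 2 = c * x ^ 2 := by rw [hNdef, mul_pow, sq_sqrt hc.le]
  obtain ⟨y, hydef⟩ : ∃ y, y = (c * N) ^ (-(1 / 3) : ℝ) := ⟨_, rfl⟩
  have hcN : 0 < c * N := by positivity
  have hy : 0 < y := by rw [hydef]; positivity
  have hy3 : y ^ 3 = (c * N)⁻¹ := by
    rw [hydef, ← rpow_natCast, ← rpow_mul hcN.le, ← rpow_neg_one]
    norm_num
  have hyN : y ^ 3 * (c * N) = 1 := by rw [hy3]; exact inv_mul_cancel₀ hcN.ne'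
  have hX : N * y = x ^ ((2 : ℝ) / 3) := by
    have h1 : (N * y) ^ 3 = x ^ 2 := by
      rw [mul_pow, hy3]
      field_simp
      linarith
    rw [show (2 : ℝ) / 3 = (2 : ℕ) * (3 : ℝ)⁻¹ by norm_num, rpow_mul hx.le, rpow_natCast, ← h1,
      ← rpow_natCast, ← rpow_mul (by positivity)]
    norm_num
  have hcs : c ^ ((3 : ℝ) / 4) * √x = √(c * N) := by
    rw [eq_comm, sqrt_eq_iff_eq_sq hcN.le (by positivity), mul_pow, sq_sqrt hx.le, hNdef,
      ← rpow_natCast, ← rpow_mul hc.le, sqrt_eq_rpow, ← mul_assoc]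
    nth_rewrite 1 [← rpow_one c]
    rw [← rpow_add hc]
    norm_num
  have hys : 1 / (y * √y) = c ^ ((3 : ℝ) / 4) * √x := by
    rw [hcs, ← sqrt_sq (by positivity : 0 ≤ 1 / (y * √y)), div_pow, mul_pow, sq_sqrt hy.le]
    congr 1
    rw [eq_comm, eq_div_iff (by positivity)]
    linarith
  have hNa : √N / c ≤ a ^ ((3 : ℝ) / 4) * √x := by
    rw [div_le_iff₀ hc]
    have h1 : √N = c ^ ((1 : ℝ) / 4) * √x := by
      rw [hNdef, sqrt_mul (sqrt_nonneg _), sqrt_eq_rpow (√c), sqrt_eq_rpow c, ← rpow_mul hc.le]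
      norm_num
    have h2 : c = c ^ ((1 : ℝ) / 4) * c ^ ((3 : ℝ) / 4) := by
      rw [← rpow_add hc]; norm_num
    have h3 : 1 ≤ a ^ ((3 : ℝ) / 4) * c ^ ((3 : ℝ) / 4) := by
      rw [← mul_rpow ha.le hc.le]
      exact one_le_rpow hac (by norm_num)
    calc √N = 1 * (c ^ ((1 : ℝ) / 4) * √x) := by rw [h1, one_mul]
      _ ≤ (a ^ ((3 : ℝ) / 4) * c ^ ((3 : ℝ) / 4)) * (c ^ ((1 : ℝ) / 4) * √x) := by gcongr
      _ = a ^ ((3 : ℝ) / 4) * √x * (c ^ ((1 : ℝ) / 4) * c ^ ((3 : ℝ) / 4)) := by ring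
      _ = a ^ ((3 : ℝ) / 4) * √x * c := by rw [← h2]
  have hT1 := abs_sum_sawtooth_ellipseBranch_le b hN hc hy hyN
  have hT2 := abs_sum_sawtooth_ellipseBranch_le (-b) hN hc hy hyN
  have hT0 := abs_sawtooth_le (N / c)
  have hS := abs_sum_chords_sub_area_le hN
  rw [show (35 : ℝ) / (y * √y) = 35 * (1 / (y * √y)) by ring, hys, hX] at hT1 hT2
  rw [ncard_ellipse_eq hc hdet hN hNx]
  set S := ∑ m ∈ Finset.range (⌊N⌋₊ + 1), √(N ^ 2 - (m : ℝ) ^ 2)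
  set T₁ := ∑ m ∈ Finset.range (⌊N⌋₊ + 1), sawtooth (ellipseBranch N c b m)
  set T₂ := ∑ m ∈ Finset.range (⌊N⌋₊ + 1), sawtooth (ellipseBranch N c (-b) m)
  have hS' : |(4 * S - 2 * N) / c - π * x ^ 2| ≤ 2 * (√N / c) := by
    have e : (4 * S - 2 * N) / c - π * x ^ 2 = (4 * S - 2 * N - π * N ^ 2) / c := by
      rw [hNx]; field_simp
    rw [e, abs_div, abs_of_pos hc, ← mul_div_assoc]
    gcongr
  rw [abs_le] at *
  constructor <;> nlinarith [hT1.1, hT1.2, hT2.1, hT2.2, hT0.1, hT0.2, hS'.1, hS'.2]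

theorem kraetzel_ellipse_explicit_bound
    (a b c : ℝ) (ha : 0 < a) (hdet : a * c - b ^ 2 = 1)
    (A : ℝ → ℕ)
    (hA : ∀ x : ℝ, A x =
      {q : ℤ × ℤ | a * (q.1 : ℝ) ^ 2 + 2 * b * (q.1 : ℝ) * (q.2 : ℝ) +
        c * (q.2 : ℝ) ^ 2 ≤ x ^ 2}.ncard)
    (P : ℝ → ℝ) (hP : ∀ x : ℝ, P x = (A x : ℝ) - Real.pi * x ^ 2) :
    ∀ x : ℝ, 1 ≤ x →
      |P x| < 38 * x ^ ((2 : ℝ) / 3) +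
        (3 * a ^ ((3 : ℝ) / 4) + 700 * c ^ ((3 : ℝ) / 4)) * Real.sqrt x + 11 := by
  intro x hx
  have hx0 : 0 < x := by linarith
  have hc : 0 ≤ c := by
    by_contra! h
    nlinarith [sq_nonneg b]
  rw [hP, hA]
  refine (abs_ncard_ellipse_sub_area_le ha hdet hx0).trans_lt ?_
  have h1 : 0 ≤ x ^ ((2 : ℝ) / 3) := by positivity
  have h2 : 0 ≤ a ^ ((3 : ℝ) / 4) * √x := by positivity
  have h3 : 0 ≤ c ^ ((3 : ℝ) / 4) * √x := by positivity
  linarith
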